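/- arXiv:2004.10953 — 2 statements merged into one kernel-verified Lean document; each statement's English description precedes it below -/
import Mathlib

section
/- Let m, n ≥ 1, let X ⊆ ℝ^m and Y ⊆ ℝ^n be semialgebraic sets, and let D ⊆ X × Y be a semialgebraic set which is stable, with dimH(X) = m, dimH(Y) = n, and dimH(D) = m + n. Then there exist a finite index set I and semialgebraic sets X_i ⊆ X and Y_i ⊆ Y for i ∈ I, with dimH(X_i) = m and dimH(Y_i) = n for each i ∈ I, such that dimH(D △ ⋃_{i∈I} X_i × Y_i) < m + n, where △ denotes symmetric difference. -/
open Set MvPolynomial MeasureTheory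
open scoped ENNReal symmDiff

def IsStable {S T : Type*} (D : Set (S × T)) : Prop :=
  ¬ ∃ (a : ℕ → S) (b : ℕ → T), ∀ i j : ℕ, (a i, b j) ∈ D ↔ i ≤ j

/-- Semialgebraic subsets of ℝ^k: the Boolean algebra generated by the sets
`{v | p v = 0}` and `{v | p v > 0}` for real polynomials `p`. -/
inductive Semialgebraic (k : ℕ) : Set (Fin k → ℝ) → Prop
  | zero (p : MvPolynomial (Fin k) ℝ) : Semialgebraic k {v | eval v p = 0}
  | pos (p : MvPolynomial (Fin k) ℝ) : Semialgebraic k {v | 0 < eval v p}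
  | compl {s : Set (Fin k → ℝ)} : Semialgebraic k s → Semialgebraic k sᶜ
  | union {s t : Set (Fin k → ℝ)} :
      Semialgebraic k s → Semialgebraic k t → Semialgebraic k (s ∪ t)

/-- The identification of ℝ^{a+b} with ℝ^a × ℝ^b. -/
def joinR (a b : ℕ) : (Fin (a + b) → ℝ) → (Fin a → ℝ) × (Fin b → ℝ) :=
  fun v => (fun i => v (Fin.castAdd b i), fun j => v (Fin.natAdd a j))

def SemialgebraicProd (m n : ℕ) (D : Set ((Fin m → ℝ) × (Fin n → ℝ))) : Prop :=
  Semialgebraic (m + n) (joinR m n ⁻¹' D)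

/-- The filter of sets containing the complement of a proper algebraic subset of `ℝ^k`. -/
def generic (k : ℕ) : Filter (Fin k → ℝ) where
  sets := {s | ∃ p : MvPolynomial (Fin k) ℝ, p ≠ 0 ∧ ∀ v, eval v p ≠ 0 → v ∈ s}
  univ_sets := ⟨1, one_ne_zero, fun _ _ => mem_univ _⟩
  sets_of_superset := fun ⟨p, hp, h⟩ hst => ⟨p, hp, fun v hv => hst (h v hv)⟩
  inter_sets := fun ⟨p, hp, h⟩ ⟨q, hq, h'⟩ => ⟨p * q, mul_ne_zero hp hq, fun v hv => by
    rw [map_mul] at hv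
    exact ⟨h v (left_ne_zero_of_mul hv), h' v (right_ne_zero_of_mul hv)⟩⟩

theorem eventually_generic_iff {k : ℕ} {Q : (Fin k → ℝ) → Prop} :
    (∀ᶠ v in generic k, Q v) ↔
      ∃ p : MvPolynomial (Fin k) ℝ, p ≠ 0 ∧ ∀ v, eval v p ≠ 0 → Q v := Iff.rfl

theorem eventually_generic_eval_ne_zero {k : ℕ} {p : MvPolynomial (Fin k) ℝ} (hp : p ≠ 0) :
    ∀ᶠ v in generic k, eval v p ≠ 0 := ⟨p, hp, fun _ h => h⟩

theorem MvPolynomial.dense_setOf_eval_ne_zero {k : ℕ} {p : MvPolynomial (Fin k) ℝ} (hp : p ≠ 0) :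
    Dense {v | eval v p ≠ 0} := by
  rw [Metric.dense_iff]
  intro v r hr
  by_contra h
  refine hp (MvPolynomial.funext_set (fun i => Metric.ball (v i) r) (fun i => ?_) fun w hw => ?_)
  · rw [Real.ball_eq_Ioo]
    exact Set.Ioo_infinite (by linarith)
  · rw [map_zero]
    by_contra hw'
    rw [← ball_pi v hr] at hw
    exact h ⟨w, hw, hw'⟩

theorem dense_of_forall_eventually_generic {k : ℕ} {ι : Type*} [Countable ι]
    {Q : ι → (Fin k → ℝ) → Prop} (h : ∀ i, ∀ᶠ v in generic k, Q i v) :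
    Dense {v | ∀ i, Q i v} := by
  choose p hp hQ using fun i => eventually_generic_iff.1 (h i)
  have hd : Dense (⋂ i, {v | eval v (p i) ≠ 0}) :=
    dense_iInter_of_isOpen (fun i => isOpen_ne_fun (p i).continuous_eval continuous_const)
      fun i => dense_setOf_eval_ne_zero (hp i)
  exact hd.mono fun v hv i => hQ i v (mem_iInter.1 hv i)

theorem exists_of_eventually_generic {k : ℕ} {Q : (Fin k → ℝ) → Prop}
    (h : ∀ᶠ v in generic k, Q v) {U : Set (Fin k → ℝ)} (hU : IsOpen U) (hne : U.Nonempty) :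
    ∃ v ∈ U, Q v := by
  obtain ⟨v, hv, hQ⟩ :=
    (dense_of_forall_eventually_generic (fun _ : Unit => h)).inter_open_nonempty U hU hne
  exact ⟨v, hv, hQ ()⟩

instance generic_neBot (k : ℕ) : (generic k).NeBot := by
  refine ⟨fun h => ?_⟩
  obtain ⟨_, _, hf⟩ := exists_of_eventually_generic (k := k) (Q := fun _ => False)
    (by rw [h]; exact Filter.mem_bot) isOpen_univ univ_nonempty
  exact hf

theorem tendsto_joinR_fst_generic (m n : ℕ) :
    Filter.Tendsto (fun v => (joinR m n v).1) (generic (m + n)) (generic m) := by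
  rintro s ⟨p, hp, hs⟩
  refine ⟨rename (Fin.castAdd n) p, ?_, fun v hv => hs _ ?_⟩
  · rwa [Ne, (rename_injective _ (Fin.castAdd_injective m n)).eq_iff' (map_zero _)]
  · rwa [eval_rename] at hv

theorem tendsto_joinR_snd_generic (m n : ℕ) :
    Filter.Tendsto (fun v => (joinR m n v).2) (generic (m + n)) (generic n) := by
  rintro s ⟨p, hp, hs⟩
  refine ⟨rename (Fin.natAdd m) p, ?_, fun v hv => hs _ ?_⟩
  · rwa [Ne, (rename_injective _ (Fin.natAdd_injective n m)).eq_iff' (map_zero _)]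
  · rwa [eval_rename] at hv

theorem joinR_append {m n : ℕ} (x : Fin m → ℝ) (y : Fin n → ℝ) :
    joinR m n (Fin.append x y) = (x, y) := by
  simp [joinR]

theorem append_joinR {m n : ℕ} (v : Fin (m + n) → ℝ) :
    Fin.append (joinR m n v).1 (joinR m n v).2 = v := Fin.append_castAdd_natAdd

theorem lipschitzWith_joinR (m n : ℕ) : LipschitzWith 1 (joinR m n) := by
  refine LipschitzWith.of_dist_le_mul fun v w => ?_
  rw [NNReal.coe_one, one_mul]
  exact max_le ((dist_pi_le_iff dist_nonneg).2 fun i => dist_le_pi_dist v w _)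
    ((dist_pi_le_iff dist_nonneg).2 fun i => dist_le_pi_dist v w _)

theorem eventually_generic_append_left {m n : ℕ} {P : MvPolynomial (Fin (m + n)) ℝ}
    {x₀ : Fin m → ℝ} {y : Fin n → ℝ} (h : eval (Fin.append x₀ y) P ≠ 0) :
    ∀ᶠ x in generic m, eval (Fin.append x y) P ≠ 0 := by
  have key : ∀ x, eval x (bind₁ (Fin.append X fun j => C (y j)) P) = eval (Fin.append x y) P := by
    intro x
    rw [← coe_aeval_eq_eval, ← coe_aeval_eq_eval, RingHom.coe_coe, RingHom.coe_coe, aeval_bind₁]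
    congr 2
    funext i
    refine Fin.addCases (fun i => ?_) (fun i => ?_) i <;> simp
  have h0 : bind₁ (Fin.append X fun j => C (y j)) P ≠ 0 := fun h0 => h (by
    rw [← key, h0, map_zero])
  simpa only [key] using eventually_generic_eval_ne_zero h0

theorem exists_polynomial_append_right {m n : ℕ} (P : MvPolynomial (Fin (m + n)) ℝ)
    (x : Fin m → ℝ) :
    ∃ R : MvPolynomial (Fin n) ℝ, ∀ y, eval y R = eval (Fin.append x y) P := by
  refine ⟨bind₁ (Fin.append (fun i => C (x i)) X) P, fun y => ?_⟩
  rw [← coe_aeval_eq_eval, ← coe_aeval_eq_eval, RingHom.coe_coe, RingHom.coe_coe, aeval_bind₁]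
  congr 2
  funext i
  refine Fin.addCases (fun i => ?_) (fun i => ?_) i <;> simp

theorem Semialgebraic.inter {k : ℕ} {s t : Set (Fin k → ℝ)} (hs : Semialgebraic k s)
    (ht : Semialgebraic k t) : Semialgebraic k (s ∩ t) := by
  simpa [compl_union] using (hs.compl.union ht.compl).compl

theorem Semialgebraic.univ {k : ℕ} : Semialgebraic k Set.univ := by
  simpa using Semialgebraic.zero (0 : MvPolynomial (Fin k) ℝ)

theorem Semialgebraic.biInter_finset {k : ℕ} {ι : Type*} (F : Finset ι)
    {s : ι → Set (Fin k → ℝ)} (hs : ∀ i ∈ F, Semialgebraic k (s i)) :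
    Semialgebraic k (⋂ i ∈ F, s i) := by
  classical
  induction F using Finset.induction_on with
  | empty => simpa using Semialgebraic.univ
  | insert a F _ ih =>
    rw [Finset.set_biInter_insert]
    exact (hs a (F.mem_insert_self a)).inter (ih fun i hi => hs i (Finset.mem_insert_of_mem hi))

theorem Semialgebraic.preimage {k l : ℕ} {s : Set (Fin k → ℝ)} (hs : Semialgebraic k s)
    (f : Fin k → MvPolynomial (Fin l) ℝ) :
    Semialgebraic l {v | (fun i => eval v (f i)) ∈ s} := by
  have key : ∀ p v, eval v (bind₁ f p) = eval (fun i => eval v (f i)) p := fun p v => by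
    rw [← coe_aeval_eq_eval, RingHom.coe_coe, aeval_bind₁]
    simp [aeval_eq_eval]
  induction hs with
  | zero p => simpa only [key] using! Semialgebraic.zero (bind₁ f p)
  | pos p => simpa only [key] using! Semialgebraic.pos (bind₁ f p)
  | compl _ ih => exact ih.compl
  | union _ _ ih ih' => exact ih.union ih'

theorem SemialgebraicProd.left_fiber {m n : ℕ} {D : Set ((Fin m → ℝ) × (Fin n → ℝ))}
    (hD : SemialgebraicProd m n D) (y : Fin n → ℝ) : Semialgebraic m {x | (x, y) ∈ D} := by
  have h := Semialgebraic.preimage hD (Fin.append X fun j => C (y j))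
  convert h using 1
  ext x
  simp [joinR]

theorem SemialgebraicProd.right_fiber {m n : ℕ} {D : Set ((Fin m → ℝ) × (Fin n → ℝ))}
    (hD : SemialgebraicProd m n D) (x : Fin m → ℝ) : Semialgebraic n {y | (x, y) ∈ D} := by
  have h := Semialgebraic.preimage hD (Fin.append (fun i => C (x i)) X)
  convert h using 1
  ext y
  simp [joinR]

theorem Semialgebraic.exists_polynomial_locally_constant {k : ℕ} {s : Set (Fin k → ℝ)}
    (hs : Semialgebraic k s) :
    ∃ p : MvPolynomial (Fin k) ℝ, p ≠ 0 ∧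
      ∀ v, eval v p ≠ 0 → ∀ᶠ w in nhds v, (w ∈ s ↔ v ∈ s) := by
  induction hs with
  | zero p =>
    by_cases hp : p = 0
    · exact ⟨1, one_ne_zero, fun v _ => by simp [hp]⟩
    · refine ⟨p, hp, fun v hv => ?_⟩
      filter_upwards [p.continuous_eval.continuousAt.eventually_ne hv] with w hw
      simp [hw, hv]
  | pos p =>
    by_cases hp : p = 0
    · exact ⟨1, one_ne_zero, fun v _ => by simp [hp]⟩
    · refine ⟨p, hp, fun v hv => ?_⟩
      rcases hv.lt_or_gt with h | h
      · filter_upwards [p.continuous_eval.continuousAt.eventually_lt_const h] with w hw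
        simp only [hw.not_gt, h.not_gt]
      · filter_upwards [p.continuous_eval.continuousAt.eventually_const_lt h] with w hw
        simp [hw, h]
  | compl _ ih =>
    obtain ⟨p, hp, h⟩ := ih
    exact ⟨p, hp, fun v hv => (h v hv).mono fun w hw => not_congr hw⟩
  | union _ _ ih ih' =>
    obtain ⟨p, hp, h⟩ := ih
    obtain ⟨q, hq, h'⟩ := ih'
    refine ⟨p * q, mul_ne_zero hp hq, fun v hv => ?_⟩
    rw [map_mul] at hv
    filter_upwards [h v (left_ne_zero_of_mul hv), h' v (right_ne_zero_of_mul hv)] with w hw hw'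
    exact or_congr hw hw'

theorem Semialgebraic.dimH_eq {k : ℕ} {s : Set (Fin k → ℝ)} (hs : Semialgebraic k s)
    (h : ∃ᶠ v in generic k, v ∈ s) : dimH s = k := by
  obtain ⟨p, hp, hloc⟩ := hs.exists_polynomial_locally_constant
  obtain ⟨v, hv, hvp⟩ := (h.and_eventually (eventually_generic_eval_ne_zero hp)).exists
  have : s ∈ nhds v := by
    filter_upwards [hloc v hvp] with w hw using hw.2 hv
  simpa using Real.dimH_of_mem_nhds this

theorem MvPolynomial.hasStrictFDerivAt_eval {k : ℕ} (p : MvPolynomial (Fin k) ℝ)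
    (v : Fin k → ℝ) :
    HasStrictFDerivAt (fun w : Fin k → ℝ => eval w p)
      (∑ i, eval v (pderiv i p) • (ContinuousLinearMap.proj i : (Fin k → ℝ) →L[ℝ] ℝ)) v := by
  induction p using MvPolynomial.induction_on with
  | C a => simpa using hasStrictFDerivAt_const a v
  | add p q hp hq =>
    simp only [map_add, add_smul, Finset.sum_add_distrib]
    exact hp.add hq
  | mul_X p j hp =>
    have h := hp.mul (hasStrictFDerivAt_apply (𝕜 := ℝ) (F' := fun _ : Fin k => ℝ) j v)
    simp only [map_mul, eval_X]
    refine h.congr_fderiv ?_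
    ext w
    have h1 : ∀ i, eval v (pderiv i (p * X j)) * w i =
        (if i = j then eval v p * w j else 0) + v j * (eval v (pderiv i p) * w i) := by
      intro i
      rw [pderiv_mul, pderiv_X]
      by_cases hij : i = j
      · subst hij; simp; ring
      · simp [hij, Ne.symm hij]; ring
    simp only [sum_apply, smul_apply, add_apply, ContinuousLinearMap.proj_apply, smul_eq_mul, h1,
      Finset.sum_add_distrib, Finset.mul_sum]
    simp

theorem dimH_setOf_coord_eq_zero_le {k : ℕ} (i : Fin (k + 1)) :
    dimH {v : Fin (k + 1) → ℝ | v i = 0} ≤ k := by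
  have h : LipschitzWith 1 (fun w : Fin k → ℝ => (i.insertNth (0 : ℝ) w : Fin (k + 1) → ℝ)) := by
    refine LipschitzWith.of_dist_le_mul fun w w' => ?_
    rw [NNReal.coe_one, one_mul, dist_pi_le_iff dist_nonneg]
    intro j
    refine Fin.succAboveCases i ?_ (fun j => ?_) j
    · simp
    · simpa using dist_le_pi_dist w w' j
  have h2 : {v : Fin (k + 1) → ℝ | v i = 0} ⊆
      range (fun w : Fin k → ℝ => (i.insertNth (0 : ℝ) w : Fin (k + 1) → ℝ)) := by
    intro v hv
    refine ⟨i.removeNth v, ?_⟩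
    have := Fin.insertNth_self_removeNth i v
    rw [mem_ofPred_eq] at hv
    rwa [hv] at this
  calc _ ≤ _ := dimH_mono h2
    _ ≤ _ := h.dimH_range_le
    _ = k := Real.dimH_univ_pi_fin k

theorem MvPolynomial.exists_nhds_dimH_zeroSet_le {k : ℕ} (p : MvPolynomial (Fin (k + 1)) ℝ)
    (i : Fin (k + 1)) (v : Fin (k + 1) → ℝ) (hv : eval v (pderiv i p) ≠ 0) :
    ∃ U ∈ nhds v, dimH (U ∩ {w | eval w p = 0}) ≤ k := by
  classical
  set d : (Fin (k + 1) → ℝ) →L[ℝ] ℝ :=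
    ∑ j, eval v (pderiv j p) • (ContinuousLinearMap.proj j : (Fin (k + 1) → ℝ) →L[ℝ] ℝ) with hd
  set L : (Fin (k + 1) → ℝ) →L[ℝ] (Fin (k + 1) → ℝ) :=
    ContinuousLinearMap.pi fun j => if j = i then d else ContinuousLinearMap.proj j with hL
  set Φ : (Fin (k + 1) → ℝ) → (Fin (k + 1) → ℝ) := fun w j => if j = i then eval w p else w j
  have hΦ : HasStrictFDerivAt Φ L v := by
    rw [hasStrictFDerivAt_pi']
    intro j
    by_cases hj : j = i
    · simpa [Φ, hL, hj] using p.hasStrictFDerivAt_eval v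
    · simpa [Φ, hL, hj] using
        hasStrictFDerivAt_apply (𝕜 := ℝ) (F' := fun _ : Fin (k + 1) => ℝ) j v
  have hinj : Function.Injective L := by
    rw [injective_iff_map_eq_zero]
    intro w hw
    have h1 : ∀ j, j ≠ i → w j = 0 := fun j hj => by simpa [hL, hj] using congrFun hw j
    have h2 : d w = 0 := by simpa [hL] using congrFun hw i
    have h3 : d w = eval v (pderiv i p) * w i := by
      simp only [hd, sum_apply, smul_apply,
        ContinuousLinearMap.proj_apply, smul_eq_mul]
      exact Finset.sum_eq_single i (fun j _ hj => by rw [h1 j hj, mul_zero]) (by simp)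
    rw [h3] at h2
    funext j
    by_cases hj : j = i
    · subst hj; simpa [hv] using h2
    · exact h1 j hj
  set e : (Fin (k + 1) → ℝ) ≃L[ℝ] (Fin (k + 1) → ℝ) :=
    (LinearEquiv.ofInjectiveEndo (L : (Fin (k + 1) → ℝ) →ₗ[ℝ] (Fin (k + 1) → ℝ)) hinj).toContinuousLinearEquiv
    with he
  have heL : (e : (Fin (k + 1) → ℝ) →L[ℝ] (Fin (k + 1) → ℝ)) = L := by
    ext w; simp [he]
  rw [← heL] at hΦ
  obtain ⟨U, hU, hlin⟩ := hΦ.approximates_deriv_on_nhds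
    (c := ‖(e.symm : (Fin (k + 1) → ℝ) →L[ℝ] (Fin (k + 1) → ℝ))‖₊⁻¹ / 2) (by
      right
      have := e.nnnorm_symm_pos
      positivity)
  refine ⟨U, hU, ?_⟩
  have hanti := hlin.antilipschitz (Or.inr (by
      have := e.nnnorm_symm_pos
      exact NNReal.half_lt_self (by positivity)))
  have h4 : U ∩ {w | eval w p = 0} = Subtype.val '' {w : U | eval w.1 p = 0} := by
    ext w; simp [and_comm]
  rw [h4, isometry_subtype_coe.dimH_image]
  refine (hanti.le_dimH_image _).trans ?_
  refine (dimH_mono ?_).trans (dimH_setOf_coord_eq_zero_le i)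
  rintro _ ⟨w, hw, rfl⟩
  simpa [Φ] using hw

theorem MvPolynomial.exists_pderiv_ne_zero {k : ℕ} (p : MvPolynomial (Fin k) ℝ)
    (hp : p.totalDegree ≠ 0) : ∃ i, pderiv i p ≠ 0 := by
  by_contra! h
  apply hp
  rw [totalDegree_eq_zero_iff]
  intro m hm i
  by_contra hmi
  have h1 := coeff_pderiv (i := i) p (m - Finsupp.single i 1)
  have h2 : m - Finsupp.single i 1 + Finsupp.single i 1 = m :=
    tsub_add_cancel_of_le (by simpa [Nat.one_le_iff_ne_zero] using hmi)
  rw [h i, h2] at h1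
  simp only [coeff_zero] at h1
  have h3 : (0 : ℝ) < ((m - Finsupp.single i 1 : Fin k →₀ ℕ) i : ℝ) + 1 := by positivity
  rw [mem_support_iff] at hm
  exact mul_ne_zero hm h3.ne' h1.symm

theorem MvPolynomial.totalDegree_pderiv_lt {k : ℕ} (p : MvPolynomial (Fin k) ℝ) (i : Fin k)
    (hp : p.totalDegree ≠ 0) : (pderiv i p).totalDegree < p.totalDegree := by
  rw [totalDegree, Finset.sup_lt_iff (by simpa using Nat.pos_of_ne_zero hp)]
  intro m hm
  rw [mem_support_iff, coeff_pderiv] at hm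
  have h := le_totalDegree (mem_support_iff.2 (left_ne_zero_of_mul hm))
  rw [Finsupp.sum_add_index' (fun _ => rfl) (fun _ _ _ => rfl), Finsupp.sum_single_index rfl] at h
  exact h

theorem MvPolynomial.dimH_zeroSet_le {k : ℕ} (p : MvPolynomial (Fin (k + 1)) ℝ) (hp : p ≠ 0) :
    dimH {v | eval v p = 0} ≤ k := by
  induction hn : p.totalDegree using Nat.strong_induction_on generalizing p with
  | _ n ih =>
  by_cases h0 : p.totalDegree = 0
  · rw [totalDegree_eq_zero_iff_eq_C] at h0
    have : {v | eval v p = 0} = ∅ := by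
      ext v
      rw [h0] at hp ⊢
      simpa using hp
    simp [this]
  obtain ⟨i, hi⟩ := p.exists_pderiv_ne_zero h0
  have h1 := ih _ (hn ▸ p.totalDegree_pderiv_lt i h0) _ hi rfl
  have h2 : dimH {v | eval v p = 0 ∧ eval v (pderiv i p) ≠ 0} ≤ k := by
    by_contra! hlt
    obtain ⟨v, hv, hmem⟩ := exists_mem_nhdsWithin_lt_dimH_of_lt_dimH hlt
    obtain ⟨U, hU, hle⟩ := p.exists_nhds_dimH_zeroSet_le i v hv.2
    refine (hmem _ (inter_mem_nhdsWithin _ hU)).not_ge ((dimH_mono ?_).trans hle)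
    exact fun w hw => ⟨hw.2, hw.1.1⟩
  calc _ ≤ dimH ({v | eval v p = 0 ∧ eval v (pderiv i p) ≠ 0} ∪ {v | eval v (pderiv i p) = 0}) :=
        dimH_mono fun v hv => by
          by_cases h : eval v (pderiv i p) = 0
          · exact Or.inr h
          · exact Or.inl ⟨hv, h⟩
    _ ≤ k := by rw [dimH_union]; exact max_le h2 h1

theorem exists_strictAnti_seq_of_not_countable {S : Set ℝ} (hS : ¬ S.Countable) :
    ∃ f : ℕ → ℝ, StrictAnti f ∧ ∀ i, f i ∈ S := by
  by_contra! h
  have hwf : S.IsWF := by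
    rw [Set.isWF_iff_no_descending_seq]
    intro f hf hmem
    obtain ⟨i, hi⟩ := h f hf
    exact hi (hmem i)
  refine hS ((countable_setOfPred_isolated_right_within (s := S)).mono fun x hx => ?_)
  refine mem_ofPred.2 ⟨hx, ?_⟩
  rw [← Filter.empty_mem_iff_bot]
  by_cases hne : (S ∩ Ioi x).Nonempty
  · have hwf' : (S ∩ Ioi x).IsWF := hwf.mono inter_subset_left
    have hmin := hwf'.min_mem hne
    rw [mem_nhdsWithin]
    refine ⟨Iio (hwf'.min hne), isOpen_Iio, hmin.2, fun z hz => ?_⟩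
    exact (hwf'.not_lt_min hne hz.2) hz.1
  · rw [Set.not_nonempty_iff_eq_empty.1 hne]
    simp

theorem IsPreconnected.subset_of_locally_constant {s A : Set ℝ} (hs : IsPreconnected s)
    (hloc : ∀ t ∈ s, ∀ᶠ t' in nhds t, (t' ∈ A ↔ t ∈ A)) {t : ℝ} (ht : t ∈ s) (htA : t ∈ A) :
    s ⊆ A := by
  have h := hs.subset_left_of_subset_union (u := interior A) (v := interior Aᶜ) isOpen_interior
    isOpen_interior (disjoint_compl_right.mono interior_subset interior_subset) ?_ ?_
  · exact h.trans interior_subset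
  · intro t' ht'
    by_cases hA : t' ∈ A
    · left
      rw [mem_interior_iff_mem_nhds]
      filter_upwards [hloc t' ht'] with w hw using hw.2 hA
    · right
      rw [mem_interior_iff_mem_nhds]
      filter_upwards [hloc t' ht'] with w hw using fun h => hA (hw.1 h)
  · refine ⟨t, ht, ?_⟩
    rw [mem_interior_iff_mem_nhds]
    filter_upwards [hloc t ht] with w hw using hw.2 htA

theorem Polynomial.exists_pos_forall_eval_ne_zero {q : Polynomial ℝ} (hq : q ≠ 0) (τ : ℝ) :
    ∃ δ > 0, ∀ t, t ≠ τ → |t - τ| < δ → q.eval t ≠ 0 := by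
  have hfin : ({t | q.eval t = 0} \ {τ}).Finite := (q.finite_setOfPred_isRoot hq).sdiff
  have := hfin.isClosed.isOpen_compl.mem_nhds (x := τ) (by simp)
  obtain ⟨δ, hδ, hsub⟩ := Metric.mem_nhds_iff.1 this
  refine ⟨δ, hδ, fun t hne ht h0 => hsub (a := t) ?_ ⟨h0, hne⟩⟩
  rwa [Metric.mem_ball, Real.dist_eq]

/-- A subset of the line which is locally constant off the zeros of `q`, contains `0` and does not
contain `1` is left through some zero of `q`. -/
theorem exists_switch {q : Polynomial ℝ} {A : Set ℝ}
    (hloc : ∀ t, q.eval t ≠ 0 → ∀ᶠ t' in nhds t, (t' ∈ A ↔ t ∈ A))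
    (hq0 : q.eval 0 ≠ 0) (h0 : (0 : ℝ) ∈ A) (hq1 : q.eval 1 ≠ 0) (h1 : (1 : ℝ) ∉ A) :
    ∃ τ ∈ Icc (0 : ℝ) 1, ∃ δ > 0, q.eval τ = 0 ∧
      (∀ t ∈ Ioo (τ - δ) τ, t ∈ A) ∧ ∀ t ∈ Ioo τ (τ + δ), t ∉ A := by
  have hq : q ≠ 0 := by rintro rfl; simp at hq0
  set T : Set ℝ := {t | t ∈ Icc (0 : ℝ) 1 ∧ ∀ t' ∈ Icc 0 t, q.eval t' ≠ 0 → t' ∈ A} with hT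
  have hbdd : BddAbove T := ⟨1, fun t ht => ht.1.2⟩
  have h0T : (0 : ℝ) ∈ T :=
    ⟨⟨le_rfl, zero_le_one⟩, fun t' ht' _ => by rwa [le_antisymm ht'.2 ht'.1]⟩
  set τ := sSup T with hτ
  have hτ0 : 0 < τ := by
    obtain ⟨ε, hε, hsub⟩ := Metric.mem_nhds_iff.1 (hloc 0 hq0)
    have hmem : min (ε / 2) 1 ∈ T := by
      refine ⟨⟨by positivity, min_le_right _ _⟩, fun t' ht' _ => (hsub ?_).2 h0⟩
      rw [Metric.mem_ball, Real.dist_eq, sub_zero, abs_of_nonneg ht'.1]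
      have := ht'.2.trans (min_le_left _ _)
      linarith
    exact lt_of_lt_of_le (by positivity) (le_csSup hbdd hmem)
  have hτ1 : τ < 1 := by
    have hev : ∀ᶠ t in nhds (1 : ℝ), q.eval t ≠ 0 ∧ t ∉ A := by
      filter_upwards [q.continuous.continuousAt.eventually_ne hq1, hloc 1 hq1] with t ht ht'
      exact ⟨ht, fun h => h1 (ht'.1 h)⟩
    obtain ⟨ε, hε, hsub⟩ := Metric.mem_nhds_iff.1 hev
    have : τ ≤ 1 - ε := by
      refine csSup_le ⟨0, h0T⟩ fun t ht => ?_
      by_contra! hlt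
      have hb : t ∈ Metric.ball (1 : ℝ) ε := by
        rw [Metric.mem_ball, Real.dist_eq, abs_lt]
        exact ⟨by linarith, by linarith [ht.1.2]⟩
      exact (hsub hb).2 (ht.2 t ⟨ht.1.1, le_rfl⟩ (hsub hb).1)
    linarith
  obtain ⟨δ₀, hδ₀, hne⟩ := Polynomial.exists_pos_forall_eval_ne_zero hq τ
  set δ := min δ₀ (min τ (1 - τ)) with hδ
  have hδ1 : δ ≤ δ₀ := min_le_left _ _
  have hδ2 : δ ≤ τ := (min_le_right _ _).trans (min_le_left _ _)
  have hδ3 : δ ≤ 1 - τ := (min_le_right _ _).trans (min_le_right _ _)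
  have hδ4 : 0 < δ := lt_min hδ₀ (lt_min hτ0 (by linarith))
  have hleft : ∀ t, 0 ≤ t → t < τ → q.eval t ≠ 0 → t ∈ A := by
    intro t ht0 ht hqt
    obtain ⟨t', ht', hlt⟩ := exists_lt_of_lt_csSup ⟨0, h0T⟩ ht
    exact ht'.2 t ⟨ht0, hlt.le⟩ hqt
  have hleft' : ∀ t ∈ Ioo (τ - δ) τ, t ∈ A := fun t ht =>
    hleft t (by linarith [ht.1]) ht.2 (hne t ht.2.ne (by
      rw [abs_lt]; constructor <;> linarith [ht.1, ht.2]))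
  have hmid : q.eval τ ≠ 0 → τ ∈ A := by
    intro hqτ
    obtain ⟨ε, hε, hsub⟩ := Metric.mem_nhds_iff.1 (hloc τ hqτ)
    have hm : 0 < min ε δ := lt_min hε hδ4
    have hm1 := min_le_left ε δ
    have hm2 := min_le_right ε δ
    refine (hsub (a := τ - min ε δ / 2) ?_).1 (hleft' _ ⟨by linarith, by linarith⟩)
    rw [Metric.mem_ball, Real.dist_eq, abs_lt]
    constructor <;> linarith
  have hneR : ∀ t ∈ Ioo τ (τ + δ), q.eval t ≠ 0 := fun t ht => hne t ht.1.ne' (by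
    rw [abs_lt]; constructor <;> linarith [ht.1, ht.2])
  have hright : ∀ t ∈ Ioo τ (τ + δ), t ∉ A := by
    intro t ht htA
    have hall : Ioo τ (τ + δ) ⊆ A := isPreconnected_Ioo.subset_of_locally_constant
      (fun t ht => hloc t (hneR t ht)) ht htA
    refine (le_csSup hbdd (a := t) ⟨⟨by linarith [ht.1], by linarith [ht.2]⟩, ?_⟩).not_gt ht.1
    intro t' ht' hqt'
    rcases lt_trichotomy t' τ with h | h | h
    · exact hleft t' ht'.1 h hqt'
    · rw [h] at hqt' ⊢
      exact hmid hqt'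
    · exact hall ⟨h, ht'.2.trans_lt ht.2⟩
  refine ⟨τ, ⟨hτ0.le, hτ1.le⟩, δ, hδ4, ?_, hleft', hright⟩
  by_contra hqτ
  obtain ⟨ε, hε, hsub⟩ := Metric.mem_nhds_iff.1 (hloc τ hqτ)
  have hm : 0 < min ε δ := lt_min hε hδ4
  have hm1 := min_le_left ε δ
  have hm2 := min_le_right ε δ
  refine hright (τ + min ε δ / 2) ⟨by linarith, by linarith⟩ ((hsub ?_).2 (hmid hqτ))
  rw [Metric.mem_ball, Real.dist_eq, abs_lt]
  constructor <;> linarith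

theorem continuous_fin_append {m n : ℕ} :
    Continuous fun z : (Fin m → ℝ) × (Fin n → ℝ) => Fin.append z.1 z.2 := by
  refine continuous_pi fun i => ?_
  refine Fin.addCases (fun i => ?_) (fun i => ?_) i
  · simpa using! (continuous_apply i).comp continuous_fst
  · simpa using! (continuous_apply i).comp continuous_snd

theorem exists_polynomial_lineMap {m n : ℕ} (P : MvPolynomial (Fin (m + n)) ℝ)
    (x : Fin m → ℝ) (y₀ y₁ : Fin n → ℝ) :
    ∃ q : Polynomial ℝ, ∀ t, q.eval t = eval (Fin.append x (AffineMap.lineMap y₀ y₁ t)) P := by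
  refine ⟨aeval (Fin.append (fun i => Polynomial.C (x i))
    fun j => Polynomial.C (y₀ j) + Polynomial.X * Polynomial.C (y₁ j - y₀ j)) P, fun t => ?_⟩
  rw [← Polynomial.coe_aeval_eq_eval, ← MvPolynomial.coe_aeval_eq_eval, RingHom.coe_coe,
    ← AlgHom.comp_apply, comp_aeval]
  congr 2
  funext i
  refine Fin.addCases (fun i => ?_) (fun i => ?_) i
  · simp
  · simp [AffineMap.lineMap_apply]
    ring

/-- If moving `y` along a segment takes a generic point of the fibre of `D` out of `D`, although
`P` vanishes identically over no point of the segment, then `D` contains a half graph. -/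
theorem not_isStable_of_fiber_change {m n : ℕ} {P : MvPolynomial (Fin (m + n)) ℝ}
    {D : Set ((Fin m → ℝ) × (Fin n → ℝ))}
    (hloc : ∀ x y, eval (Fin.append x y) P ≠ 0 → ∀ᶠ z in nhds (x, y), (z ∈ D ↔ (x, y) ∈ D))
    {y₀ y₁ : Fin n → ℝ}
    (hseg : ∀ t ∈ Icc (0 : ℝ) 1,
      ∀ᶠ x in generic m, eval (Fin.append x (AffineMap.lineMap y₀ y₁ t)) P ≠ 0)
    {x₀ : Fin m → ℝ} (h₀ : eval (Fin.append x₀ y₀) P ≠ 0) (h₁ : eval (Fin.append x₀ y₁) P ≠ 0)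
    (hD₀ : (x₀, y₀) ∈ D) (hD₁ : (x₀, y₁) ∉ D) : ¬ IsStable D := by
  set γ : ℝ → Fin n → ℝ := fun t => AffineMap.lineMap y₀ y₁ t with hγ
  have hγc : Continuous γ := AffineMap.lineMap_continuous
  have hγ0 : γ 0 = y₀ := AffineMap.lineMap_apply_zero _ _
  have hγ1 : γ 1 = y₁ := AffineMap.lineMap_apply_one _ _
  have hcont : ∀ y, Continuous fun x : Fin m → ℝ => eval (Fin.append x y) P := fun y =>
    P.continuous_eval.comp (continuous_fin_append.comp (continuous_id.prodMk continuous_const))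
  have hslice : ∀ y, Continuous fun x : Fin m → ℝ => (x, (y : Fin n → ℝ)) := fun y =>
    continuous_id.prodMk continuous_const
  have hev : ∀ᶠ x in nhds x₀, eval (Fin.append x y₀) P ≠ 0 ∧ eval (Fin.append x y₁) P ≠ 0 ∧
      (x, y₀) ∈ D ∧ (x, y₁) ∉ D := by
    filter_upwards [(hcont y₀).continuousAt.eventually_ne h₀,
      (hcont y₁).continuousAt.eventually_ne h₁,
      (hslice y₀).continuousAt.eventually (hloc x₀ y₀ h₀),
      (hslice y₁).continuousAt.eventually (hloc x₀ y₁ h₁)] with x a b c d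
    exact ⟨a, b, c.2 hD₀, fun h => hD₁ (d.1 h)⟩
  obtain ⟨U, hUsub, hUo, hxU⟩ := mem_nhds_iff.1 hev
  have hsw : ∀ x ∈ U, ∃ τ ∈ Icc (0 : ℝ) 1, ∃ δ > 0, eval (Fin.append x (γ τ)) P = 0 ∧
      (∀ t ∈ Ioo (τ - δ) τ, (x, γ t) ∈ D) ∧ ∀ t ∈ Ioo τ (τ + δ), (x, γ t) ∉ D := by
    intro x hx
    obtain ⟨q, hq⟩ := exists_polynomial_lineMap P x y₀ y₁
    obtain ⟨a, b, c, d⟩ := hUsub hx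
    have := exists_switch (q := q) (A := {t | (x, γ t) ∈ D}) (fun t ht => ?_)
      (by rw [hq]; simpa using a) (by simpa [hγ0] using c) (by rw [hq]; simpa using b)
      (by simpa [hγ1] using d)
    · simpa only [hq] using! this
    · rw [hq] at ht
      exact (Continuous.prodMk continuous_const hγc).continuousAt.eventually (hloc x (γ t) ht)
  choose! τ hτ δ hδ hzero hin hout using hsw
  have hunc : ¬ (τ '' U).Countable := by
    intro hcount
    have : Countable (τ '' U) := hcount
    have hd := dense_of_forall_eventually_generic (ι := τ '' U)
      (Q := fun t x => eval (Fin.append x (γ t)) P ≠ 0) (by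
        rintro ⟨_, x, hx, rfl⟩
        exact hseg _ (hτ x hx))
    obtain ⟨x, hx, hx'⟩ := hd.inter_open_nonempty U hUo ⟨x₀, hxU⟩
    exact hx' ⟨τ x, x, hx, rfl⟩ (hzero x hx)
  have hcov : τ '' U ⊆ ⋃ kr : ℕ × ℚ,
      τ '' {x ∈ U | 1 / ((kr.1 : ℝ) + 1) < δ x ∧ |τ x - kr.2| < 1 / ((kr.1 : ℝ) + 1) / 2} := by
    rintro _ ⟨x, hx, rfl⟩
    obtain ⟨k, hk⟩ := exists_nat_one_div_lt (hδ x hx)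
    have hpos : (0 : ℝ) < 1 / ((k : ℝ) + 1) / 2 := by positivity
    obtain ⟨r, hr1, hr2⟩ := exists_rat_btwn (lt_add_of_pos_right (τ x) hpos)
    refine mem_iUnion.2 ⟨(k, r), x, ⟨hx, hk, ?_⟩, rfl⟩
    rw [abs_lt]
    constructor <;> linarith
  have : ∃ kr : ℕ × ℚ, ¬ (τ '' {x ∈ U | 1 / ((kr.1 : ℝ) + 1) < δ x ∧
      |τ x - kr.2| < 1 / ((kr.1 : ℝ) + 1) / 2}).Countable := by
    by_contra! h
    exact hunc ((countable_iUnion h).mono hcov)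
  obtain ⟨⟨k, r⟩, hkr⟩ := this
  obtain ⟨f, hf, hmem⟩ := exists_strictAnti_seq_of_not_countable hkr
  choose a ha haf using hmem
  refine fun hst => hst ⟨a, fun j => γ ((f j + f (j + 1)) / 2), fun i j => ?_⟩
  have hfj := hf (Nat.lt_succ_self j)
  obtain ⟨hiU, hiδ, hir⟩ := ha i
  have h1 := (ha j).2.2
  have h2 := (ha (j + 1)).2.2
  simp only [haf, abs_lt] at hir h1 h2
  constructor
  · intro hmemD
    by_contra! hlt
    have hle : f i ≤ f (j + 1) := hf.antitone hlt
    refine hout (a i) hiU _ ?_ hmemD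
    rw [haf]
    constructor <;> linarith
  · intro hij
    have hle : f j ≤ f i := hf.antitone hij
    refine hin (a i) hiU _ ?_
    rw [haf]
    constructor <;> linarith

theorem MvPolynomial.exists_optionElim_relation {n : ℕ}
    (f : Fin n → MvPolynomial (Fin n) ℝ) (g : MvPolynomial (Fin n) ℝ) :
    ∃ Q : Polynomial (MvPolynomial (Fin n) ℝ), Q ≠ 0 ∧
      ∀ x, (Q.map (eval fun i => eval x (f i))).eval (eval x g) = 0 := by
  have hdep : ¬ AlgebraicIndependent ℝ (fun o : Option (Fin n) => o.elim g f) := by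
    intro h
    have h1 := h.cardinalMk_le_trdeg
    rw [MvPolynomial.trdeg_of_isDomain] at h1
    simp at h1
  rw [algebraicIndependent_iff] at hdep
  push Not at hdep
  obtain ⟨p, hp, hp0⟩ := hdep
  refine ⟨optionEquivLeft ℝ (Fin n) p, by simpa using hp0, fun x => ?_⟩
  have key : ∀ p : MvPolynomial (Option (Fin n)) ℝ,
      ((optionEquivLeft ℝ (Fin n) p).map (eval fun i => eval x (f i))).eval (eval x g) =
        eval x (aeval (fun o : Option (Fin n) => o.elim g f) p) := by
    intro p
    induction p using MvPolynomial.induction_on with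
    | C a => simp [optionEquivLeft_C]
    | add p q hp hq => simp [hp, hq]
    | mul_X p o hp =>
      cases o <;> simp [hp, optionEquivLeft_X_some, optionEquivLeft_X_none]
  rw [key, hp, map_zero]

/-- Generic fibres of a polynomial map `ℝ^n → ℝ^n` are finite, of uniformly bounded size. -/
theorem MvPolynomial.exists_card_fiber_le {n : ℕ} (f : Fin n → MvPolynomial (Fin n) ℝ) :
    ∃ B : ℕ, ∀ᶠ c in generic n, ∀ s : Finset (Fin n → ℝ),
      (∀ x ∈ s, ∀ i, eval x (f i) = c i) → s.card ≤ B := by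
  choose Q hQ0 hQ using fun j => exists_optionElim_relation f (X j)
  refine ⟨∏ j, (Q j).natDegree, ?_⟩
  have hlead : ∀ᶠ c in generic n, ∀ j, eval c (Q j).leadingCoeff ≠ 0 :=
    Filter.eventually_all.2 fun j =>
      eventually_generic_eval_ne_zero (Polynomial.leadingCoeff_ne_zero.2 (hQ0 j))
  filter_upwards [hlead] with c hc s hs
  have hne : ∀ j, (Q j).map (eval c) ≠ 0 := fun j h => hc j (by
    have := congrArg (fun q => q.coeff (Q j).natDegree) h
    simpa [Polynomial.coeff_map] using this)
  have hsub : s ⊆ Fintype.piFinset fun j => ((Q j).map (eval c)).roots.toFinset := by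
    intro x hx
    rw [Fintype.mem_piFinset]
    intro j
    rw [Multiset.mem_toFinset, Polynomial.mem_roots (hne j), Polynomial.IsRoot]
    have := hQ j x
    rwa [eval_X, _root_.funext (hs x hx)] at this
  refine (Finset.card_le_card hsub).trans ?_
  rw [Fintype.card_piFinset]
  refine Finset.prod_le_prod' fun j _ => ?_
  exact (Multiset.toFinset_card_le _).trans
    ((Polynomial.card_roots' _).trans Polynomial.natDegree_map_le)

theorem MvPolynomial.eval_pderiv_eq_of_isLocalExtr {n : ℕ} (H : MvPolynomial (Fin n) ℝ)
    (c x : Fin n → ℝ)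
    (hx : IsLocalExtr (fun w : Fin n → ℝ => eval w (H - ∑ i, C (c i) * X i)) x) (j : Fin n) :
    eval x (pderiv j H) = c j := by
  have h0 := hx.hasFDerivAt_eq_zero (hasStrictFDerivAt_eval _ x).hasFDerivAt
  have h1 := congrArg (fun L : (Fin n → ℝ) →L[ℝ] ℝ => L (Pi.single j 1)) h0
  simp only [sum_apply, smul_apply, ContinuousLinearMap.proj_apply, smul_eq_mul, zero_apply] at h1
  rw [Finset.sum_eq_single j (fun i _ hi => by simp [hi]) (by simp)] at h1
  simp only [Pi.single_eq_same, mul_one, map_sub, map_sum] at h1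
  have h2 : ∑ i, eval x (pderiv j (C (c i) * X i)) = c j := by
    rw [Finset.sum_eq_single j (fun i _ hi => by simp [pderiv_X_of_ne hi]) (by simp)]
    simp
  linarith

/-- A polynomial has at most boundedly many disjoint bounded open sets on whose frontiers it
vanishes without vanishing identically inside. -/
theorem MvPolynomial.exists_card_nodal_le {n : ℕ} (H : MvPolynomial (Fin n) ℝ) :
    ∃ B : ℕ, ∀ {ι : Type} (s : Finset ι) (V : ι → Set (Fin n → ℝ)),
      (∀ i ∈ s, IsOpen (V i)) → (∀ i ∈ s, Bornology.IsBounded (V i)) →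
      (∀ i ∈ s, ∃ v ∈ V i, eval v H ≠ 0) →
      (∀ i ∈ s, ∀ x ∈ closure (V i), x ∉ V i → eval x H = 0) →
      (∀ i ∈ s, ∀ j ∈ s, ∀ x ∈ V i, x ∈ V j → i = j) → s.card ≤ B := by
  classical
  obtain ⟨B, hB⟩ := exists_card_fiber_le fun j => pderiv j H
  refine ⟨B, fun {ι} s V hopen hbdd hne hfr hdisj => ?_⟩
  choose! v hv hvH using hne
  have hc : ∀ᶠ c in nhds (0 : Fin n → ℝ), ∀ i ∈ s, ∀ x ∈ closure (V i),
      |∑ j, c j * x j| < |eval (v i) H| / 2 := by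
    rw [Filter.eventually_all_finset]
    intro i hi
    have hpos : 0 < |eval (v i) H| / 2 := by have := abs_pos.2 (hvH i hi); positivity
    have hK : IsCompact (closure (V i)) := (hbdd i hi).isCompact_closure
    have hF : Continuous fun z : (Fin n → ℝ) × (Fin n → ℝ) => |∑ j, z.1 j * z.2 j| := by fun_prop
    refine (hK.eventually_forall_of_forall_eventually (P := fun (c x : Fin n → ℝ) =>
      |∑ j, c j * x j| < |eval (v i) H| / 2) fun x _ => ?_)
    exact hF.continuousAt.eventually_lt_const (by simpa using hpos)
  obtain ⟨U, hUsub, hUo, h0U⟩ := mem_nhds_iff.1 hc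
  obtain ⟨c, hcU, hcB⟩ := exists_of_eventually_generic hB hUo ⟨0, h0U⟩
  have hsmall := hUsub hcU
  have hcrit : ∀ i ∈ s, ∃ x ∈ V i, ∀ j, eval x (pderiv j H) = c j := by
    intro i hi
    have hev : ∀ w, eval w (H - ∑ j, C (c j) * X j) = eval w H - ∑ j, c j * w j := fun w => by simp
    have hcont := (H - ∑ j, C (c j) * X j).continuous_eval.continuousOn (s := closure (V i))
    have hK : IsCompact (closure (V i)) := (hbdd i hi).isCompact_closure
    have hvc := subset_closure (hv i hi)
    have hva := abs_lt.1 (hsmall i hi _ hvc)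
    rcases (hvH i hi).lt_or_gt with hneg | hpos
    · obtain ⟨x, hx, hmin⟩ := hK.exists_isMinOn ⟨_, hvc⟩ hcont
      have hxV : x ∈ V i := by
        by_contra hxV
        have h1 := isMinOn_iff.1 hmin _ hvc
        rw [hev, hev, hfr i hi x hx hxV] at h1
        have h2 := abs_lt.1 (hsmall i hi x hx)
        rw [abs_of_neg hneg] at hva h2
        linarith
      exact ⟨x, hxV, fun j => H.eval_pderiv_eq_of_isLocalExtr c x (Or.inl (hmin.isLocalMin
        (Filter.mem_of_superset ((hopen i hi).mem_nhds hxV) subset_closure))) j⟩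
    · obtain ⟨x, hx, hmax⟩ := hK.exists_isMaxOn ⟨_, hvc⟩ hcont
      have hxV : x ∈ V i := by
        by_contra hxV
        have h1 := isMaxOn_iff.1 hmax _ hvc
        rw [hev, hev, hfr i hi x hx hxV] at h1
        have h2 := abs_lt.1 (hsmall i hi x hx)
        rw [abs_of_pos hpos] at hva h2
        linarith
      exact ⟨x, hxV, fun j => H.eval_pderiv_eq_of_isLocalExtr c x (Or.inr (hmax.isLocalMax
        (Filter.mem_of_superset ((hopen i hi).mem_nhds hxV) subset_closure))) j⟩
  choose! x hxV hx using hcrit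
  have hinj : Set.InjOn x s := fun i hi j hj hij =>
    hdisj i hi j hj (x i) (hxV i hi) (hij ▸ hxV j hj)
  rw [← Finset.card_image_of_injOn hinj]
  refine hcB _ fun y hy => ?_
  obtain ⟨i, hi, rfl⟩ := Finset.mem_image.1 hy
  exact hx i hi

theorem MvPolynomial.exists_clear_denominator {n : ℕ} (W R : MvPolynomial (Fin n) ℝ) :
    ∃ (M : ℕ) (G : MvPolynomial (Fin n) ℝ), ∀ u : Fin n → ℝ, eval u W ≠ 0 →
      eval u G = eval ((eval u W)⁻¹ • u) R * eval u W ^ M := by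
  induction R using MvPolynomial.induction_on with
  | C a => exact ⟨0, C a, fun u _ => by simp⟩
  | add p q hp hq =>
    obtain ⟨M, G, h⟩ := hp
    obtain ⟨M', G', h'⟩ := hq
    refine ⟨M + M', G * W ^ M' + G' * W ^ M, fun u hu => ?_⟩
    simp only [map_add, map_mul, map_pow, h u hu, h' u hu]
    ring
  | mul_X p i hp =>
    obtain ⟨M, G, h⟩ := hp
    refine ⟨M + 1, G * X i, fun u hu => ?_⟩
    simp only [map_mul, h u hu, eval_X, Pi.smul_apply, smul_eq_mul]
    field_simp
    ring

theorem exists_ball_preimage {n : ℕ} (y : Fin n → ℝ) :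
    ∃ u : Fin n → ℝ, 0 < 1 - ∑ i, u i ^ 2 ∧ (1 - ∑ i, u i ^ 2)⁻¹ • u = y := by
  set a := ∑ i, y i ^ 2 with ha
  have ha0 : 0 ≤ a := Finset.sum_nonneg fun i _ => sq_nonneg _
  have hcont : ContinuousOn (fun l : ℝ => l - (1 - l ^ 2 * a)) (Icc 0 1) := by fun_prop
  obtain ⟨l, hl, hl0⟩ := intermediate_value_Icc zero_le_one hcont
    (show (0 : ℝ) ∈ Icc _ _ from ⟨by norm_num, by norm_num; exact ha0⟩)
  have hw : 1 - ∑ i, (l • y) i ^ 2 = l := by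
    simp only [Pi.smul_apply, smul_eq_mul, mul_pow, ← Finset.mul_sum, ← ha]
    simp only at hl0
    linarith
  have hlpos : 0 < l := by
    rcases hl.1.lt_or_eq with h | h
    · exact h
    · rw [← h] at hl0; norm_num at hl0
  exact ⟨l • y, by rwa [hw], by rw [hw, smul_smul, inv_mul_cancel₀ hlpos.ne', one_smul]⟩

/-- An equivalence relation with open classes on the complement of a real hypersurface has
finitely many classes there. -/
theorem Setoid.exists_finset_of_locally_constant {n : ℕ} (R : MvPolynomial (Fin n) ℝ)
    (r : Setoid (Fin n → ℝ)) (hr : ∀ y, eval y R ≠ 0 → ∀ᶠ y' in nhds y, r y' y) :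
    ∃ F : Finset (Fin n → ℝ), (∀ y ∈ F, eval y R ≠ 0) ∧
      ∀ y, eval y R ≠ 0 → ∃ y' ∈ F, r y y' := by
  classical
  set W : MvPolynomial (Fin n) ℝ := 1 - ∑ i, X i ^ 2 with hW
  have hWe : ∀ u, eval u W = 1 - ∑ i, u i ^ 2 := fun u => by simp [hW]
  set φ : (Fin n → ℝ) → (Fin n → ℝ) := fun u => (eval u W)⁻¹ • u with hφ
  have hφc : ∀ u, eval u W ≠ 0 → ContinuousAt φ u := fun u hu =>
    (W.continuous_eval.continuousAt.inv₀ hu).smul continuousAt_id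
  obtain ⟨M, G, hG⟩ := exists_clear_denominator W R
  obtain ⟨B, hB⟩ := exists_card_nodal_le (G * W)
  have hopen : ∀ y, eval y R ≠ 0 → ∀ᶠ y' in nhds y, eval y' R ≠ 0 ∧ r y' y := fun y hy =>
    (R.continuous_eval.continuousAt.eventually_ne hy).and (hr y hy)
  have hGne : ∀ u, eval u W ≠ 0 → (eval u (G * W) ≠ 0 ↔ eval (φ u) R ≠ 0) := fun u hu => by
    rw [map_mul, hG u hu]
    simp [hu, hφ]
  have hcard : ∀ F : Finset (Fin n → ℝ), (∀ y ∈ F, eval y R ≠ 0) →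
      (∀ y ∈ F, ∀ y' ∈ F, r y y' → y = y') → F.card ≤ B := by
    intro F hF hinj
    refine hB F (fun y => {u | 0 < eval u W ∧ eval (φ u) R ≠ 0 ∧ r (φ u) y}) ?_ ?_ ?_ ?_ ?_
    · intro y hy
      rw [isOpen_iff_mem_nhds]
      rintro u ⟨hu, huR, hur⟩
      filter_upwards [W.continuous_eval.continuousAt.eventually_const_lt hu,
        (hφc u hu.ne').eventually (hopen _ huR)] with w hw hw'
      exact ⟨hw, hw'.1, r.trans hw'.2 hur⟩
    · intro y hy
      refine (Metric.isBounded_closedBall (x := (0 : Fin n → ℝ)) (r := 1)).subset ?_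
      rintro u ⟨hu, -⟩
      rw [mem_closedBall_zero_iff, pi_norm_le_iff_of_nonneg zero_le_one]
      intro i
      rw [hWe] at hu
      have := Finset.single_le_sum (f := fun i => u i ^ 2) (fun i _ => sq_nonneg _)
        (Finset.mem_univ i)
      rw [Real.norm_eq_abs]
      exact abs_le_one_iff_mul_self_le_one.2 (by nlinarith)
    · intro y hy
      obtain ⟨u, hu, huy⟩ := exists_ball_preimage y
      rw [← hWe] at hu huy
      have huR : eval (φ u) R ≠ 0 := by rw [hφ]; simpa only [huy] using hF y hy
      refine ⟨u, ⟨hu, huR, ?_⟩, (hGne u hu.ne').2 huR⟩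
      simp only [hφ, huy]
      exact r.refl y
    · intro y hy u hu hnot
      by_contra hne
      have hWu : eval u W ≠ 0 := by
        rw [map_mul] at hne
        exact right_ne_zero_of_mul hne
      have hWnn : 0 ≤ eval u W := by
        have hcl : IsClosed {u | 0 ≤ eval u W} :=
          isClosed_le continuous_const W.continuous_eval
        exact closure_minimal (fun w hw => hw.1.le) hcl hu
      have huR := (hGne u hWu).1 hne
      obtain ⟨w, hwr, hwV⟩ := mem_closure_iff_nhds.1 hu _ ((hφc u hWu).eventually (hr _ huR))
      exact hnot ⟨lt_of_le_of_ne hWnn hWu.symm, huR, r.trans (r.symm hwr) hwV.2.2⟩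
    · intro y hy y' hy' u hu hu'
      exact hinj y hy y' hy' (r.trans (r.symm hu.2.2) hu'.2.2)
  set A : Set ℕ := {k | ∃ F : Finset (Fin n → ℝ), (∀ y ∈ F, eval y R ≠ 0) ∧
    (∀ y ∈ F, ∀ y' ∈ F, r y y' → y = y') ∧ F.card = k} with hA
  have hAb : BddAbove A := ⟨B, by rintro _ ⟨F, h1, h2, rfl⟩; exact hcard F h1 h2⟩
  have hAne : A.Nonempty := ⟨0, ∅, by simp, by simp, rfl⟩
  obtain ⟨F, h1, h2, h3⟩ := Nat.sSup_mem hAne hAb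
  refine ⟨F, h1, fun y hy => ?_⟩
  by_contra! hno
  have hyF : y ∉ F := fun h => hno y h (r.refl y)
  have hmem : F.card + 1 ∈ A := by
    refine ⟨insert y F, ?_, ?_, Finset.card_insert_of_notMem hyF⟩
    · simpa [Finset.forall_mem_insert] using ⟨hy, h1⟩
    · intro a ha b hb hab
      rcases Finset.mem_insert.1 ha with rfl | ha' <;> rcases Finset.mem_insert.1 hb with rfl | hb'
      · rfl
      · exact (hno b hb' hab).elim
      · exact (hno a ha' (r.symm hab)).elim
      · exact h2 a ha' b hb' hab
  have := le_csSup hAb hmem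
  omega

theorem dimH_lt_of_eventually_generic_notMem {k : ℕ} (hk : 1 ≤ k) {s : Set (Fin k → ℝ)}
    (hs : ∀ᶠ v in generic k, v ∉ s) : dimH s < (k : ℝ≥0∞) := by
  obtain ⟨k, rfl⟩ := Nat.exists_eq_add_of_le' hk
  obtain ⟨p, hp, h⟩ := eventually_generic_iff.1 hs
  have hsub : s ⊆ {v | eval v p = 0} := fun v hv => by
    by_contra hne
    exact h v hne hv
  calc dimH s ≤ dimH {v | eval v p = 0} := dimH_mono hsub
    _ ≤ k := dimH_zeroSet_le p hp
    _ < (k + 1 : ℕ) := by exact_mod_cast k.lt_succ_self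

theorem dimH_prod_lt_of_eventually_generic_notMem {m n : ℕ} (hmn : 1 ≤ m + n)
    {s : Set ((Fin m → ℝ) × (Fin n → ℝ))}
    (hs : ∀ᶠ v in generic (m + n), joinR m n v ∉ s) : dimH s < ((m + n : ℕ) : ℝ≥0∞) := by
  have himage : joinR m n '' (joinR m n ⁻¹' s) = s :=
    image_preimage_eq s fun z => ⟨Fin.append z.1 z.2, joinR_append z.1 z.2⟩
  calc dimH s = dimH (joinR m n '' (joinR m n ⁻¹' s)) := by rw [himage]
    _ ≤ dimH (joinR m n ⁻¹' s) := (lipschitzWith_joinR m n).dimH_image_le _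
    _ < ((m + n : ℕ) : ℝ≥0∞) := dimH_lt_of_eventually_generic_notMem hmn hs

theorem mem_iff_mem_of_eventually_generic {m n : ℕ} {P : MvPolynomial (Fin (m + n)) ℝ}
    {D : Set ((Fin m → ℝ) × (Fin n → ℝ))}
    (hloc : ∀ x y, eval (Fin.append x y) P ≠ 0 → ∀ᶠ z in nhds (x, y), (z ∈ D ↔ (x, y) ∈ D))
    {y y' : Fin n → ℝ} (h : ∀ᶠ x in generic m, ((x, y) ∈ D ↔ (x, y') ∈ D))
    {x : Fin m → ℝ} (hy : eval (Fin.append x y) P ≠ 0) (hy' : eval (Fin.append x y') P ≠ 0) :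
    (x, y) ∈ D ↔ (x, y') ∈ D := by
  have hslice : ∀ y : Fin n → ℝ, eval (Fin.append x y) P ≠ 0 →
      ∀ᶠ w in nhds x, ((w, y) ∈ D ↔ (x, y) ∈ D) := fun y hy =>
    (Continuous.prodMk_left y).continuousAt.eventually (hloc x y hy)
  obtain ⟨U, hU, hUo, hxU⟩ := mem_nhds_iff.1 ((hslice y hy).and (hslice y' hy'))
  obtain ⟨w, hwU, hw⟩ := exists_of_eventually_generic h hUo ⟨x, hxU⟩
  rw [← (hU hwU).1, hw, (hU hwU).2]

theorem IsStable.eventually_generic_mem_iff {m n : ℕ} {P : MvPolynomial (Fin (m + n)) ℝ}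
    {D : Set ((Fin m → ℝ) × (Fin n → ℝ))} (hstable : IsStable D)
    (hloc : ∀ x y, eval (Fin.append x y) P ≠ 0 → ∀ᶠ z in nhds (x, y), (z ∈ D ↔ (x, y) ∈ D))
    {y y' : Fin n → ℝ}
    (hseg : ∀ w ∈ segment ℝ y y', ∀ᶠ x in generic m, eval (Fin.append x w) P ≠ 0) :
    ∀ᶠ x in generic m, ((x, y) ∈ D ↔ (x, y') ∈ D) := by
  have hline : ∀ {a b : Fin n → ℝ},
      (∀ w ∈ segment ℝ a b, ∀ᶠ x in generic m, eval (Fin.append x w) P ≠ 0) →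
      ∀ t ∈ Icc (0 : ℝ) 1,
        ∀ᶠ x in generic m, eval (Fin.append x (AffineMap.lineMap a b t)) P ≠ 0 :=
    fun {a b} h t ht => h _ (by
      rw [segment_eq_image_lineMap]
      exact mem_image_of_mem _ ht)
  filter_upwards [hseg y (left_mem_segment ℝ y y'), hseg y' (right_mem_segment ℝ y y')]
    with x hy hy'
  constructor <;> intro h <;> by_contra h'
  · exact not_isStable_of_fiber_change hloc (hline hseg) hy hy' h h' hstable
  · exact not_isStable_of_fiber_change hloc (hline (segment_symm ℝ y y' ▸ hseg)) hy' hy h h' hstable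

/-- The fibres of a stable semialgebraic relation fall, generically, into finitely many classes
modulo generic equality. -/
theorem IsStable.exists_finset_fiber {m n : ℕ} {P : MvPolynomial (Fin (m + n)) ℝ} (hP : P ≠ 0)
    {D : Set ((Fin m → ℝ) × (Fin n → ℝ))} (hstable : IsStable D)
    (hloc : ∀ x y, eval (Fin.append x y) P ≠ 0 → ∀ᶠ z in nhds (x, y), (z ∈ D ↔ (x, y) ∈ D)) :
    ∃ F : Finset (Fin n → ℝ),
      (∀ y ∈ F, ∀ᶠ x in generic m, eval (Fin.append x y) P ≠ 0) ∧
      ∀ᶠ y in generic n, ∃ z ∈ F, ∀ᶠ x in generic m, ((x, y) ∈ D ↔ (x, z) ∈ D) := by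
  obtain ⟨v, hv⟩ := (eventually_generic_eval_ne_zero hP).exists
  rw [← append_joinR v] at hv
  obtain ⟨R, hR⟩ := exists_polynomial_append_right P (joinR m n v).1
  have hR0 : R ≠ 0 := by
    rintro rfl
    exact hv (by rw [← hR, map_zero])
  have hgen : ∀ y, eval y R ≠ 0 → ∀ᶠ x in generic m, eval (Fin.append x y) P ≠ 0 := fun y hy =>
    eventually_generic_append_left (by rwa [← hR])
  let r : Setoid (Fin n → ℝ) :=
    { r := fun y y' => ∀ᶠ x in generic m, ((x, y) ∈ D ↔ (x, y') ∈ D)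
      iseqv := ⟨fun _ => Filter.Eventually.of_forall fun _ => Iff.rfl,
        fun h => h.mono fun _ hx => hx.symm,
        fun h h' => (h.and h').mono fun _ hx => hx.1.trans hx.2⟩ }
  obtain ⟨F, hF, hcover⟩ := Setoid.exists_finset_of_locally_constant R r fun y hy => by
    obtain ⟨ε, hε, hball⟩ := Metric.eventually_nhds_iff_ball.1
      (R.continuous_eval.continuousAt.eventually_ne hy)
    filter_upwards [Metric.ball_mem_nhds y hε] with y' hy'
    exact hstable.eventually_generic_mem_iff hloc fun w hw => hgen w (hball w
      ((convex_ball y ε).segment_subset hy' (Metric.mem_ball_self hε) hw))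
  exact ⟨F, fun y hy => hgen y (hF y hy), (eventually_generic_eval_ne_zero hR0).mono hcover⟩

/-- A stable semialgebraic relation is generically a finite union of semialgebraic boxes. -/
theorem IsStable.exists_finset_boxes {m n : ℕ} {X : Set (Fin m → ℝ)} {Y : Set (Fin n → ℝ)}
    {D : Set ((Fin m → ℝ) × (Fin n → ℝ))} (hY : Semialgebraic n Y) (hDsub : D ⊆ X ×ˢ Y)
    (hD : SemialgebraicProd m n D) (hstable : IsStable D) :
    ∃ (F : Finset (Fin n → ℝ)) (Xs : (Fin n → ℝ) → Set (Fin m → ℝ))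
      (Ys : (Fin n → ℝ) → Set (Fin n → ℝ)),
      (∀ z, Semialgebraic m (Xs z)) ∧ (∀ z, Semialgebraic n (Ys z)) ∧
      (∀ z, Xs z ⊆ X) ∧ (∀ z, Ys z ⊆ Y) ∧
      ∀ᶠ v in generic (m + n), (joinR m n v ∈ D ↔ ∃ z ∈ F, joinR m n v ∈ Xs z ×ˢ Ys z) := by
  classical
  obtain ⟨P, hP, hPloc⟩ := hD.exists_polynomial_locally_constant
  have hloc : ∀ x y, eval (Fin.append x y) P ≠ 0 →
      ∀ᶠ z in nhds (x, y), (z ∈ D ↔ (x, y) ∈ D) := fun x y h => by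
    have hc : Filter.Tendsto (fun z : (Fin m → ℝ) × (Fin n → ℝ) => Fin.append z.1 z.2)
        (nhds (x, y)) (nhds (Fin.append x y)) := continuous_fin_append.tendsto (x, y)
    simpa only [mem_preimage, joinR_append] using hc.eventually (hPloc _ h)
  obtain ⟨F, hF, hcover⟩ := hstable.exists_finset_fiber hP hloc
  set r : (Fin n → ℝ) → (Fin n → ℝ) → Prop := fun y y' =>
    ∀ᶠ x in generic m, ((x, y) ∈ D ↔ (x, y') ∈ D)
  have hξ : ∀ z z', ∃ x, (∀ y ∈ F, eval (Fin.append x y) P ≠ 0) ∧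
      (¬ r z z' → ¬ ((x, z) ∈ D ↔ (x, z') ∈ D)) := by
    intro z z'
    have hev := (Filter.eventually_all_finset F).2 hF
    by_cases h : r z z'
    · obtain ⟨x, hx⟩ := hev.exists
      exact ⟨x, hx, fun h' => absurd h h'⟩
    · obtain ⟨x, hx, hx'⟩ := ((Filter.not_eventually.1 h).and_eventually hev).exists
      exact ⟨x, hx', fun _ => hx⟩
  choose ξ hξF hξD using hξ
  have hξgen : ∀ᶠ y in generic n, ∀ z ∈ F, ∀ z' ∈ F, eval (Fin.append (ξ z z') y) P ≠ 0 := by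
    refine (Filter.eventually_all_finset F).2 fun z hz =>
      (Filter.eventually_all_finset F).2 fun z' _ => ?_
    obtain ⟨Q, hQ⟩ := exists_polynomial_append_right P (ξ z z')
    have hQ0 : Q ≠ 0 := by
      rintro rfl
      exact hξF z z' z hz (by rw [← hQ, map_zero])
    simpa only [hQ] using eventually_generic_eval_ne_zero hQ0
  refine ⟨F, fun z => {x | (x, z) ∈ D},
    fun z => Y ∩ ⋂ z' ∈ F.filter fun z' => ¬ r z z',
      {y | (ξ z z', y) ∈ D ↔ (ξ z z', z) ∈ D},
    fun z => hD.left_fiber z, fun z => hY.inter (Semialgebraic.biInter_finset _ fun z' _ => ?_),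
    fun z x hx => (hDsub hx).1, fun z => inter_subset_left, ?_⟩
  · by_cases h : (ξ z z', z) ∈ D
    · simpa only [h, iff_true] using hD.right_fiber (ξ z z')
    · simpa only [h, iff_false] using! (hD.right_fiber (ξ z z')).compl
  filter_upwards [eventually_generic_eval_ne_zero hP,
    (tendsto_joinR_fst_generic m n).eventually ((Filter.eventually_all_finset F).2 hF),
    (tendsto_joinR_snd_generic m n).eventually (hcover.and hξgen)] with v hv hvF hvr
  obtain ⟨⟨y', hy'F, hy'⟩, hvξ⟩ := hvr
  rw [← append_joinR v] at hv
  generalize joinR m n v = w at hv hvF hy' hvξ ⊢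
  obtain ⟨x, y⟩ := w
  dsimp only at hv hvF hy' hvξ
  simp only [mem_prod, mem_inter_iff, mem_iInter, Finset.mem_filter]
  constructor
  · intro hxy
    refine ⟨y', hy'F, (mem_iff_mem_of_eventually_generic hloc hy' hv (hvF y' hy'F)).1 hxy,
      (hDsub hxy).2, fun z hz => ?_⟩
    exact mem_iff_mem_of_eventually_generic hloc hy' (hvξ y' hy'F z hz.1) (hξF y' z y' hy'F)
  · rintro ⟨z, hzF, hxz, -, hyz⟩
    by_cases hzy : r z y'
    · refine (mem_iff_mem_of_eventually_generic hloc ?_ hv (hvF z hzF)).2 hxz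
      filter_upwards [hy', hzy] with x hx hx'
      rw [hx, hx']
    · have h1 := mem_iff_mem_of_eventually_generic hloc hy' (hvξ z hzF y' hy'F)
        (hξF z y' y' hy'F)
      exact absurd ((hyz y' ⟨hy'F, hzy⟩).symm.trans h1) (hξD z y' hzy)

theorem stmt3 (m n : ℕ) (hm : 1 ≤ m) (hn : 1 ≤ n)
    (X : Set (Fin m → ℝ)) (Y : Set (Fin n → ℝ)) (D : Set ((Fin m → ℝ) × (Fin n → ℝ)))
    (hX : Semialgebraic m X) (hY : Semialgebraic n Y) (hDsub : D ⊆ X ×ˢ Y)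
    (hD : SemialgebraicProd m n D) (hstable : IsStable D)
    (hdX : dimH X = (m : ℝ≥0∞)) (hdY : dimH Y = (n : ℝ≥0∞))
    (hdD : dimH D = ((m + n : ℕ) : ℝ≥0∞)) :
    ∃ (k : ℕ) (Xs : Fin k → Set (Fin m → ℝ)) (Ys : Fin k → Set (Fin n → ℝ)),
      (∀ i, Semialgebraic m (Xs i)) ∧ (∀ i, Semialgebraic n (Ys i)) ∧
      (∀ i, Xs i ⊆ X) ∧ (∀ i, Ys i ⊆ Y) ∧
      (∀ i, dimH (Xs i) = (m : ℝ≥0∞)) ∧ (∀ i, dimH (Ys i) = (n : ℝ≥0∞)) ∧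
      dimH (symmDiff D (⋃ i, (Xs i) ×ˢ (Ys i))) < ((m + n : ℕ) : ℝ≥0∞) := by
  classical
  obtain ⟨F, Xs, Ys, hXs, hYs, hXsub, hYsub, hiff⟩ := hstable.exists_finset_boxes hY hDsub hD
  set F' := F.filter fun z => (∃ᶠ x in generic m, x ∈ Xs z) ∧ ∃ᶠ y in generic n, y ∈ Ys z
  set e := F'.equivFin.symm
  have he : ∀ i, (∃ᶠ x in generic m, x ∈ Xs (e i)) ∧ ∃ᶠ y in generic n, y ∈ Ys (e i) :=
    fun i => (Finset.mem_filter.1 (e i).2).2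
  refine ⟨F'.card, fun i => Xs (e i), fun i => Ys (e i), fun i => hXs _, fun i => hYs _,
    fun i => hXsub _, fun i => hYsub _, fun i => (hXs _).dimH_eq (he i).1,
    fun i => (hYs _).dimH_eq (he i).2,
    dimH_prod_lt_of_eventually_generic_notMem (hm.trans (Nat.le_add_right m n)) ?_⟩
  have hsmall : ∀ᶠ v in generic (m + n), ∀ z ∈ F, joinR m n v ∈ Xs z ×ˢ Ys z → z ∈ F' := by
    refine (Filter.eventually_all_finset F).2 fun z hz => ?_
    by_cases hzX : ∃ᶠ x in generic m, x ∈ Xs z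
    · by_cases hzY : ∃ᶠ y in generic n, y ∈ Ys z
      · exact Filter.Eventually.of_forall fun _ _ => Finset.mem_filter.2 ⟨hz, hzX, hzY⟩
      · filter_upwards [(tendsto_joinR_snd_generic m n).eventually (Filter.not_frequently.1 hzY)]
          with v hv hmem using absurd hmem.2 hv
    · filter_upwards [(tendsto_joinR_fst_generic m n).eventually (Filter.not_frequently.1 hzX)]
        with v hv hmem using absurd hmem.1 hv
  filter_upwards [hiff, hsmall] with v hv hvF
  have hU : joinR m n v ∈ ⋃ i, Xs (e i) ×ˢ Ys (e i) ↔ joinR m n v ∈ D := by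
    rw [mem_iUnion, hv]
    constructor
    · rintro ⟨i, hi⟩
      exact ⟨e i, (Finset.mem_filter.1 (e i).2).1, hi⟩
    · rintro ⟨z, hz, hmem⟩
      exact ⟨e.symm ⟨z, hvF z hz hmem⟩, by simpa only [Equiv.apply_symm_apply] using hmem⟩
  rw [mem_symmDiff]
  tauto
end

section
/- Let m, n ≥ 1, let X ⊆ ℝ^m and Y ⊆ ℝ^n be sets definable with parameters in the first-order structure (ℝ, +, <), and let D ⊆ X × Y be definable with parameters in (ℝ, +, <), stable, with dimH(X) = m, dimH(Y) = n, and dimH(D) = m + n. Then there exist a finite index set I and sets X_i ⊆ X and Y_i ⊆ Y definable with parameters in (ℝ, +, <) for i ∈ I, with dimH(X_i) = m and dimH(Y_i) = n for each i ∈ I, such that dimH(D △ ⋃_{i∈I} X_i × Y_i) < m + n, where △ denotes symmetric difference. -/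
open Set FirstOrder MeasureTheory
open scoped ENNReal symmDiff

/-- The language of ordered groups: one binary function symbol `+`
and one binary relation symbol `<`. -/
def OAGLang : Language where
  Functions := fun n => match n with | 2 => Unit | _ => Empty
  Relations := fun n => match n with | 2 => Unit | _ => Empty

/-- The structure `(ℝ, +, <)`. -/
instance : OAGLang.Structure ℝ where
  funMap := fun {n} f x =>
    match n, f with
    | 2, _ => x 0 + x 1
  RelMap := fun {n} r x =>
    match n, r with
    | 2, _ => x 0 < x 1

/-! ### Rational linear functions and semilinear sets -/

/-- The `ℚ`-space of functions on `ℝ^ι` spanned by the coordinates and the real constants. -/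
noncomputable def linFun (ι : Type*) : Submodule ℚ ((ι → ℝ) → ℝ) :=
  Submodule.span ℚ (range (fun (i : ι) (v : ι → ℝ) => v i) ∪
    range (fun (c : ℝ) (_ : ι → ℝ) => c))

section LinFun

variable {ι κ : Type*}

theorem coord_mem_linFun (i : ι) : (fun v : ι → ℝ => v i) ∈ linFun ι :=
  Submodule.subset_span (Or.inl ⟨i, rfl⟩)

theorem const_mem_linFun (c : ℝ) : (fun _ : ι → ℝ => c) ∈ linFun ι :=
  Submodule.subset_span (Or.inr ⟨c, rfl⟩)

theorem linFun_induction {p : ((ι → ℝ) → ℝ) → Prop}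
    (coord : ∀ i, p (fun v => v i)) (const : ∀ c : ℝ, p (fun _ => c))
    (add : ∀ f g, p f → p g → p (f + g)) (smul : ∀ (q : ℚ) f, p f → p (q • f))
    {f : (ι → ℝ) → ℝ} (hf : f ∈ linFun ι) : p f := by
  refine Submodule.span_induction (p := fun f _ => p f) ?_ (const 0)
    (fun f g _ _ => add f g) (fun q f _ => smul q f) hf
  rintro _ (⟨i, rfl⟩ | ⟨c, rfl⟩)
  exacts [coord i, const c]

theorem linFun_comp {σ : (κ → ℝ) → (ι → ℝ)} (hσ : ∀ i, (fun w => σ w i) ∈ linFun κ)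
    {f : (ι → ℝ) → ℝ} (hf : f ∈ linFun ι) : f ∘ σ ∈ linFun κ := by
  refine linFun_induction (p := fun f => f ∘ σ ∈ linFun κ) hσ const_mem_linFun
    (fun f g hf hg => ?_) (fun q f hf => ?_) hf
  · exact (linFun κ).add_mem hf hg
  · exact (linFun κ).smul_mem q hf

/-- A set is semilinear if membership depends only on the signs of finitely many rational linear
functions. -/
def IsSemilinear (S : Set (ι → ℝ)) : Prop :=
  ∃ F : Set ((ι → ℝ) → ℝ), F.Finite ∧ F ⊆ linFun ι ∧
    ∀ v w, (∀ f ∈ F, f v < 0 ↔ f w < 0) → v ∈ S → w ∈ S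

theorem isSemilinear_lt_zero {f : (ι → ℝ) → ℝ} (hf : f ∈ linFun ι) :
    IsSemilinear {v | f v < 0} :=
  ⟨{f}, finite_singleton f, by simpa using hf, fun _ _ h => (h f rfl).1⟩

theorem IsSemilinear.compl {S : Set (ι → ℝ)} (hS : IsSemilinear S) : IsSemilinear Sᶜ := by
  obtain ⟨F, hF, hF', h⟩ := hS
  exact ⟨F, hF, hF', fun v w hvw hv hw => hv (h w v (fun f hf => (hvw f hf).symm) hw)⟩

theorem isSemilinear_iUnion {J : Type*} [Finite J] {S : J → Set (ι → ℝ)}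
    (hS : ∀ j, IsSemilinear (S j)) : IsSemilinear (⋃ j, S j) := by
  choose F hF hF' h using hS
  refine ⟨⋃ j, F j, finite_iUnion hF, iUnion_subset hF', fun v w hvw hv => ?_⟩
  obtain ⟨j, hj⟩ := mem_iUnion.1 hv
  exact mem_iUnion.2 ⟨j, h j v w (fun f hf => hvw f (mem_iUnion.2 ⟨j, hf⟩)) hj⟩

theorem IsSemilinear.union {S T : Set (ι → ℝ)} (hS : IsSemilinear S) (hT : IsSemilinear T) :
    IsSemilinear (S ∪ T) := by
  rw [union_eq_iUnion]
  exact isSemilinear_iUnion (by rintro (_ | _) <;> assumption)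

theorem IsSemilinear.preimage {σ : (κ → ℝ) → (ι → ℝ)} (hσ : ∀ i, (fun w => σ w i) ∈ linFun κ)
    {S : Set (ι → ℝ)} (hS : IsSemilinear S) : IsSemilinear (σ ⁻¹' S) := by
  obtain ⟨F, hF, hF', h⟩ := hS
  refine ⟨(fun f => f ∘ σ) '' F, hF.image _, ?_, fun v w hvw hv => h _ _ (fun f hf => ?_) hv⟩
  · rintro _ ⟨f, hf, rfl⟩
    exact linFun_comp hσ (hF' hf)
  · exact hvw _ ⟨f, hf, rfl⟩

/-! ### Quantifier elimination -/

/-- Given finitely many reals, any real `t` can be replaced by a midpoint of two of them or a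
shift by `±1` of one of them, or `0`, without changing its position relative to them. -/
theorem exists_test_point {J : Type*} [Finite J] (r : J → ℝ) (t : ℝ) :
    ∃ s : ℝ, (s = 0 ∨ (∃ i, s = r i - 1) ∨ (∃ i, s = r i + 1) ∨ ∃ i j, s = (r i + r j) / 2) ∧
      ∀ i, (r i < t ↔ r i < s) ∧ (t < r i ↔ s < r i) := by
  by_cases h0 : ∃ i, r i = t
  · obtain ⟨i, rfl⟩ := h0
    exact ⟨r i, Or.inr (Or.inr (Or.inr ⟨i, i, by ring⟩)), fun j => ⟨Iff.rfl, Iff.rfl⟩⟩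
  push Not at h0
  by_cases hlo : ∃ i, r i < t <;> by_cases hhi : ∃ i, t < r i
  · obtain ⟨i, hi, hi'⟩ := Set.exists_max_image {i | r i < t} r (toFinite _) hlo
    obtain ⟨j, hj, hj'⟩ := Set.exists_min_image {i | t < r i} r (toFinite _) hhi
    simp only [mem_ofPred_eq] at hi hi' hj hj'
    refine ⟨(r i + r j) / 2, Or.inr (Or.inr (Or.inr ⟨i, j, rfl⟩)), fun k => ?_⟩
    rcases lt_or_gt_of_ne (h0 k) with hk | hk
    · have := hi' k hk
      exact ⟨⟨fun _ => by linarith, fun _ => hk⟩, ⟨fun _ => by linarith, fun _ => by linarith⟩⟩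
    · have := hj' k hk
      exact ⟨⟨fun _ => by linarith, fun _ => by linarith⟩, ⟨fun _ => by linarith, fun _ => hk⟩⟩
  · obtain ⟨i, hi, hi'⟩ := Set.exists_max_image {i | r i < t} r (toFinite _) hlo
    push Not at hhi
    refine ⟨r i + 1, Or.inr (Or.inr (Or.inl ⟨i, rfl⟩)), fun k => ?_⟩
    have hk := lt_of_le_of_ne (hhi k) (h0 k)
    have := hi' k hk
    exact ⟨⟨fun _ => by linarith, fun _ => hk⟩, ⟨fun _ => by linarith, fun _ => by linarith⟩⟩
  · obtain ⟨i, hi, hi'⟩ := Set.exists_min_image {i | t < r i} r (toFinite _) hhi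
    push Not at hlo
    refine ⟨r i - 1, Or.inr (Or.inl ⟨i, rfl⟩), fun k => ?_⟩
    have hk := lt_of_le_of_ne (hlo k) (h0 k).symm
    have := hi' k hk
    exact ⟨⟨fun _ => by linarith, fun _ => by linarith⟩, ⟨fun _ => by linarith, fun _ => hk⟩⟩
  · push Not at hlo hhi
    exact ⟨0, Or.inl rfl, fun k => (h0 k (le_antisymm (hhi k) (hlo k))).elim⟩

/-- Append a last bound variable to a valuation. -/
def extendVal {α : Type*} {n : ℕ} (w : α ⊕ Fin n → ℝ) (t : ℝ) : α ⊕ Fin (n + 1) → ℝ :=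
  Sum.elim (w ∘ Sum.inl) (Fin.snoc (α := fun _ => ℝ) (w ∘ Sum.inr) t)

theorem linFun_extendVal {α : Type*} {n : ℕ} {f : (α ⊕ Fin (n + 1) → ℝ) → ℝ}
    (hf : f ∈ linFun (α ⊕ Fin (n + 1))) :
    ∃ g ∈ linFun (α ⊕ Fin n), ∃ q : ℚ, ∀ w t, f (extendVal w t) = g w + q * t := by
  refine linFun_induction (p := fun f => ∃ g ∈ linFun (α ⊕ Fin n), ∃ q : ℚ,
    ∀ w t, f (extendVal w t) = g w + q * t) ?_ ?_ ?_ ?_ hf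
  · rintro (a | i)
    · exact ⟨_, coord_mem_linFun (Sum.inl a), 0, fun w t => by simp [extendVal]⟩
    · refine Fin.lastCases ?_ (fun i => ?_) i
      · exact ⟨_, const_mem_linFun 0, 1, fun w t => by simp [extendVal]⟩
      · exact ⟨_, coord_mem_linFun (Sum.inr i), 0, fun w t => by simp [extendVal]⟩
  · exact fun c => ⟨_, const_mem_linFun c, 0, fun w t => by simp⟩
  · rintro f f' ⟨g, hg, q, h⟩ ⟨g', hg', q', h'⟩
    refine ⟨g + g', add_mem hg hg', q + q', fun w t => ?_⟩
    simp only [Pi.add_apply, h, h', Rat.cast_add]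
    ring
  · rintro r f ⟨g, hg, q, h⟩
    refine ⟨r • g, Submodule.smul_mem _ _ hg, r * q, fun w t => ?_⟩
    simp only [Pi.smul_apply, h, Rat.smul_def, Rat.cast_mul]
    ring

theorem extendVal_mem_linFun {α : Type*} {n : ℕ} {τ : (α ⊕ Fin n → ℝ) → ℝ}
    (hτ : τ ∈ linFun (α ⊕ Fin n)) (i : α ⊕ Fin (n + 1)) :
    (fun w => extendVal w (τ w) i) ∈ linFun (α ⊕ Fin n) := by
  rcases i with a | i
  · exact coord_mem_linFun (Sum.inl a)
  · refine Fin.lastCases ?_ (fun i => ?_) i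
    · simpa [extendVal] using hτ
    · simpa [extendVal] using coord_mem_linFun (Sum.inr i)

theorem IsSemilinear.exists_extendVal {α : Type*} {n : ℕ} {S : Set (α ⊕ Fin (n + 1) → ℝ)}
    (hS : IsSemilinear S) : IsSemilinear {w : α ⊕ Fin n → ℝ | ∃ t, extendVal w t ∈ S} := by
  obtain ⟨F, hF, hF', h⟩ := id hS
  have : Finite F := hF
  choose g hg q hgq using fun f : F => linFun_extendVal (hF' f.2)
  let r : F → (α ⊕ Fin n → ℝ) → ℝ := fun f => (-(q f)⁻¹) • g f
  have hr : ∀ f, r f ∈ linFun _ := fun f => Submodule.smul_mem _ _ (hg f)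
  let τ : Unit ⊕ F ⊕ F ⊕ F × F → (α ⊕ Fin n → ℝ) → ℝ :=
    Sum.elim (fun _ _ => 0) (Sum.elim (fun f w => r f w - 1) (Sum.elim (fun f w => r f w + 1)
      (fun f w => (r f.1 w + r f.2 w) / 2)))
  have hτ : ∀ j, τ j ∈ linFun _ := by
    rintro (_ | f | f | f)
    · exact const_mem_linFun 0
    · exact sub_mem (hr f) (const_mem_linFun 1)
    · exact add_mem (hr f) (const_mem_linFun 1)
    · have : τ (Sum.inr (Sum.inr (Sum.inr f))) = (1 / 2 : ℚ) • (r f.1 + r f.2) := by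
        funext w
        simp only [τ, Sum.elim_inr, Pi.smul_apply, Pi.add_apply, Rat.smul_def]
        push_cast
        ring
      rw [this]
      exact Submodule.smul_mem _ _ (add_mem (hr _) (hr _))
  have key : {w : α ⊕ Fin n → ℝ | ∃ t, extendVal w t ∈ S} =
      ⋃ j, (fun w => extendVal w (τ j w)) ⁻¹' S := by
    ext w
    simp only [mem_ofPred_eq, mem_iUnion, mem_preimage]
    refine ⟨fun ⟨t, ht⟩ => ?_, fun ⟨j, hj⟩ => ⟨_, hj⟩⟩
    obtain ⟨s, hs, hst⟩ := exists_test_point (fun f => r f w) t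
    have hsS : extendVal w s ∈ S := by
      refine h _ _ (fun f hf => ?_) ht
      rw [show f = ((⟨f, hf⟩ : F) : _ → ℝ) from rfl, hgq, hgq]
      obtain ⟨h1, h2⟩ := hst ⟨f, hf⟩
      generalize (⟨f, hf⟩ : F) = f' at h1 h2 ⊢
      have hrf : r f' w = -(q f' : ℝ)⁻¹ * g f' w := by
        simp [r, Rat.smul_def]
      rcases lt_trichotomy (q f') 0 with hq | hq | hq
      · have hq' : (q f' : ℝ) < 0 := by exact_mod_cast hq
        have e : g f' w = -(q f' : ℝ) * r f' w := by rw [hrf]; field_simp [hq'.ne, hq'.ne']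
        have e' : ∀ x : ℝ, g f' w + q f' * x < 0 ↔ r f' w < x := fun x => by
          rw [e]
          constructor
          · intro h; nlinarith
          · intro h; nlinarith
        rw [e', e', h1]
      · simp [hq]
      · have hq' : (0 : ℝ) < (q f' : ℝ) := by exact_mod_cast hq
        have e : g f' w = -(q f' : ℝ) * r f' w := by rw [hrf]; field_simp [hq'.ne, hq'.ne']
        have e' : ∀ x : ℝ, g f' w + q f' * x < 0 ↔ x < r f' w := fun x => by
          rw [e]
          constructor
          · intro h; nlinarith
          · intro h; nlinarith
        rw [e', e', h2]
    rcases hs with rfl | ⟨i, rfl⟩ | ⟨i, rfl⟩ | ⟨i, j, rfl⟩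
    · exact ⟨Sum.inl (), hsS⟩
    · exact ⟨Sum.inr (Sum.inl i), hsS⟩
    · exact ⟨Sum.inr (Sum.inr (Sum.inl i)), hsS⟩
    · exact ⟨Sum.inr (Sum.inr (Sum.inr (i, j))), hsS⟩
  rw [key]
  exact isSemilinear_iUnion fun j => hS.preimage (extendVal_mem_linFun (hτ j))

theorem realize_term_mem_linFun (t : OAGLang[[(univ : Set ℝ)]].Term ι) :
    (fun v : ι → ℝ => t.realize v) ∈ linFun ι := by
  induction t with
  | var i => exact coord_mem_linFun i
  | @func l f ts ih =>
    rcases f with f | f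
    · match l, f with
      | 2, _ => exact add_mem (ih 0) (ih 1)
    · match l, f with
      | 0, c => exact const_mem_linFun (c : (univ : Set ℝ)).1

theorem isSemilinear_realize {α : Type*} {n : ℕ}
    (φ : OAGLang[[(univ : Set ℝ)]].BoundedFormula α n) :
    IsSemilinear {w : α ⊕ Fin n → ℝ | φ.Realize (w ∘ Sum.inl) (w ∘ Sum.inr)} := by
  have hlt : ∀ {k : ℕ} (s t : OAGLang[[(univ : Set ℝ)]].Term (α ⊕ Fin k)),
      IsSemilinear {w : α ⊕ Fin k → ℝ | s.realize w < t.realize w} := fun s t => by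
    simpa using isSemilinear_lt_zero
      (sub_mem (realize_term_mem_linFun s) (realize_term_mem_linFun t))
  induction φ with
  | falsum => exact ⟨∅, finite_empty, empty_subset _, fun _ _ _ h => h⟩
  | equal s t =>
    convert ((hlt s t).union (hlt t s)).compl using 1
    ext w
    simp only [Language.BoundedFormula.Realize, mem_ofPred_eq, mem_compl_iff, mem_union,
      Sum.elim_comp_inl_inr, not_or, not_lt]
    exact ⟨fun h => ⟨h.ge, h.le⟩, fun h => le_antisymm h.2 h.1⟩
  | @rel k l R ts =>
    rcases R with R | R
    · match l, R with
      | 2, _ =>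
        convert hlt (ts 0) (ts 1) using 1
        ext w
        simp only [Language.BoundedFormula.Realize, mem_ofPred_eq, Sum.elim_comp_inl_inr]
        rfl
    · exact (R : Empty).elim
  | imp φ ψ hφ hψ =>
    convert hφ.compl.union hψ using 1
    ext w
    simp only [Language.BoundedFormula.Realize, mem_ofPred_eq, mem_compl_iff, mem_union]
    tauto
  | all φ hφ =>
    convert hφ.compl.exists_extendVal.compl using 1
    ext w
    simp [Language.BoundedFormula.Realize, extendVal]

theorem _root_.Set.Definable.isSemilinear {S : Set (ι → ℝ)}
    (hS : (univ : Set ℝ).Definable OAGLang S) : IsSemilinear S := by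
  obtain ⟨φ, rfl⟩ := hS
  refine IsSemilinear.preimage (σ := fun v => Sum.elim v Fin.elim0) ?_ (isSemilinear_realize φ)
  rintro (i | i)
  · exact coord_mem_linFun i
  · exact i.elim0

/-! ### Definability of half-spaces -/

theorem linFun_eq_sub_terms {f : (ι → ℝ) → ℝ} (hf : f ∈ linFun ι) :
    ∃ N : ℕ, 0 < N ∧ ∃ s t : OAGLang[[(univ : Set ℝ)]].Term ι,
      ∀ v, N * f v = s.realize v - t.realize v := by
  let addSym : OAGLang[[(univ : Set ℝ)]].Functions 2 := Sum.inl ()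
  have con : ∀ c : ℝ, ∃ t : OAGLang[[(univ : Set ℝ)]].Term ι, ∀ v : ι → ℝ, t.realize v = c :=
    fun c => ⟨(OAGLang.con (⟨c, mem_univ c⟩ : (univ : Set ℝ))).term, fun v => by simp⟩
  have add : ∀ s t : OAGLang[[(univ : Set ℝ)]].Term ι,
      ∃ u : OAGLang[[(univ : Set ℝ)]].Term ι, ∀ v : ι → ℝ, u.realize v = s.realize v + t.realize v :=
    fun s t => ⟨addSym.apply₂ s t, fun v => by
      rw [Language.Term.realize_functions_apply₂]; rfl⟩
  have nsmul : ∀ (k : ℕ) (s : OAGLang[[(univ : Set ℝ)]].Term ι),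
      ∃ u : OAGLang[[(univ : Set ℝ)]].Term ι, ∀ v : ι → ℝ, u.realize v = k * s.realize v := by
    intro k s
    induction k with
    | zero => simpa using con 0
    | succ k ih =>
      obtain ⟨u, hu⟩ := ih
      obtain ⟨u', hu'⟩ := add u s
      exact ⟨u', fun v => by rw [hu', hu]; push_cast; ring⟩
  refine linFun_induction (p := fun f => ∃ N : ℕ, 0 < N ∧
    ∃ s t : OAGLang[[(univ : Set ℝ)]].Term ι, ∀ v, N * f v = s.realize v - t.realize v)
    ?_ ?_ ?_ ?_ hf
  · intro i
    obtain ⟨t, ht⟩ := con 0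
    exact ⟨1, one_pos, .var i, t, fun v => by simp [ht]⟩
  · intro c
    obtain ⟨s, hs⟩ := con c
    obtain ⟨t, ht⟩ := con 0
    exact ⟨1, one_pos, s, t, fun v => by simp [hs, ht]⟩
  · rintro f g ⟨N, hN, s, t, h⟩ ⟨M, hM, s', t', h'⟩
    obtain ⟨a, ha⟩ := nsmul M s
    obtain ⟨b, hb⟩ := nsmul N s'
    obtain ⟨c, hc⟩ := nsmul M t
    obtain ⟨d, hd⟩ := nsmul N t'
    obtain ⟨x, hx⟩ := add a b
    obtain ⟨y, hy⟩ := add c d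
    refine ⟨N * M, by positivity, x, y, fun v => ?_⟩
    rw [hx, hy, ha, hb, hc, hd, Pi.add_apply]
    push_cast
    linear_combination (M : ℝ) * h v + N * h' v
  · rintro q f ⟨N, hN, s, t, h⟩
    have hq : (q.den : ℝ) * q = q.num := by exact_mod_cast Rat.den_mul_eq_num q
    obtain ⟨k, hk | hk⟩ := q.num.eq_nat_or_neg
    all_goals
      obtain ⟨a, ha⟩ := nsmul k s
      obtain ⟨b, hb⟩ := nsmul k t
      rw [hk] at hq
      push_cast at hq
    · refine ⟨q.den * N, Nat.mul_pos q.den_pos hN, a, b, fun v => ?_⟩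
      rw [ha, hb, Pi.smul_apply, Rat.smul_def]
      push_cast
      linear_combination (N : ℝ) * f v * hq + k * h v
    · refine ⟨q.den * N, Nat.mul_pos q.den_pos hN, b, a, fun v => ?_⟩
      rw [ha, hb, Pi.smul_apply, Rat.smul_def]
      push_cast
      linear_combination (N : ℝ) * f v * hq - k * h v

theorem definable_lt_zero {f : (ι → ℝ) → ℝ} (hf : f ∈ linFun ι) :
    (univ : Set ℝ).Definable OAGLang {v | f v < 0} := by
  obtain ⟨N, hN, s, t, h⟩ := linFun_eq_sub_terms hf
  let ltSym : OAGLang[[(univ : Set ℝ)]].Relations 2 := Sum.inl ()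
  refine ⟨ltSym.formula₂ s t, ?_⟩
  ext v
  have e : f v < 0 ↔ s.realize v < t.realize v := by
    rw [← sub_neg (a := s.realize v), ← h]
    have : (0 : ℝ) < N := by exact_mod_cast hN
    constructor <;> intro h <;> nlinarith
  refine e.trans (Iff.trans ?_ Language.Formula.realize_rel₂.symm)
  rfl

end LinFun

/-! ### Affine functions and stability -/

section Affine

variable {V : Type*} [NormedAddCommGroup V] [NormedSpace ℝ V]

/-- A real function is affine if it is a continuous linear functional plus a constant. -/
def IsAffineFun (f : V → ℝ) : Prop :=
  ∃ (L : V →L[ℝ] ℝ) (c : ℝ), ∀ z, f z = L z + c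

theorem IsAffineFun.continuous {f : V → ℝ} (hf : IsAffineFun f) : Continuous f := by
  obtain ⟨L, c, h⟩ := hf
  rw [funext h]
  fun_prop

theorem IsAffineFun.add {f g : V → ℝ} (hf : IsAffineFun f) (hg : IsAffineFun g) :
    IsAffineFun (f + g) := by
  obtain ⟨L, c, h⟩ := hf
  obtain ⟨M, d, h'⟩ := hg
  refine ⟨L + M, c + d, fun z => ?_⟩
  simp only [Pi.add_apply, h, h', add_apply]
  ring

theorem IsAffineFun.smul {f : V → ℝ} (hf : IsAffineFun f) (a : ℝ) : IsAffineFun (a • f) := by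
  obtain ⟨L, c, h⟩ := hf
  exact ⟨a • L, a * c, fun z => by simp [h, mul_add]⟩

theorem IsAffineFun.comp {W : Type*} [NormedAddCommGroup W] [NormedSpace ℝ W] {f : V → ℝ}
    (hf : IsAffineFun f) (M : W →L[ℝ] V) : IsAffineFun (f ∘ M) := by
  obtain ⟨L, c, h⟩ := hf
  exact ⟨L.comp M, c, fun z => by simp [h]⟩

theorem IsAffineFun.apply_lineMap {f : V → ℝ} (hf : IsAffineFun f) (x y : V) (a b : ℝ)
    (hab : a + b = 1) : f (a • x + b • y) = a * f x + b * f y := by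
  obtain ⟨L, c, h⟩ := hf
  simp only [h, map_add, map_smul, smul_eq_mul]
  linear_combination (-c) * hab

theorem convex_lt_zero {f : V → ℝ} (hf : IsAffineFun f) : Convex ℝ {z | f z < 0} := by
  obtain ⟨L, c, h⟩ := hf
  have : {z | f z < 0} = {z | L z < -c} := by
    ext z
    simp only [mem_ofPred_eq, h]
    constructor <;> intro h <;> linarith
  rw [this]
  exact convex_halfSpace_lt L.isLinear _

theorem IsAffineFun.dimH_zeros_lt [FiniteDimensional ℝ V] (hV : 0 < Module.finrank ℝ V)
    {f : V → ℝ} (hf : IsAffineFun f) (h0 : f ≠ 0) :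
    dimH {z | f z = 0} < Module.finrank ℝ V := by
  rcases Set.eq_empty_or_nonempty {z | f z = 0} with he | ⟨p, hp⟩
  · rw [he, dimH_empty]
    exact_mod_cast hV
  obtain ⟨L, c, h⟩ := hf
  have hp' : L p + c = 0 := (h p).symm.trans hp
  have hiso : Isometry (fun k : L.ker => (k : V) + p) :=
    (isometry_add_right p).comp isometry_subtype_coe
  have hset : {z | f z = 0} = (fun k : L.ker => (k : V) + p) '' univ := by
    ext z
    constructor
    · intro hz
      have hz' : L z + c = 0 := (h z).symm.trans hz
      exact ⟨⟨z - p, by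
        rw [LinearMap.mem_ker]
        simp only [ContinuousLinearMap.coe_coe, map_sub]
        linarith⟩, mem_univ _, by simp⟩
    · rintro ⟨k, -, rfl⟩
      have := k.2
      rw [LinearMap.mem_ker] at this
      simp only [ContinuousLinearMap.coe_coe] at this
      simp [h, this, hp']
  rw [hset, hiso.dimH_image, Real.dimH_univ_eq_finrank]
  refine Nat.cast_lt.2 (Submodule.finrank_lt fun htop => h0 ?_)
  funext z
  have hLz : ∀ z, L z = 0 := fun z => by
    have : z ∈ L.ker := htop ▸ Submodule.mem_top
    simpa using this
  simpa [h, hLz] using hp'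

theorem dimH_iUnion_zeros_lt [FiniteDimensional ℝ V] (hV : 0 < Module.finrank ℝ V)
    {F : Set (V → ℝ)} (hF : F.Finite) (hA : ∀ f ∈ F, IsAffineFun f) (h0 : ∀ f ∈ F, f ≠ 0) :
    dimH {z | ∃ f ∈ F, f z = 0} < Module.finrank ℝ V := by
  induction F, hF using Set.Finite.induction_on with
  | empty => simpa using hV
  | @insert f F _ _ ih =>
    have : {z | ∃ g ∈ insert f F, g z = 0} = {z | f z = 0} ∪ {z | ∃ g ∈ F, g z = 0} := by
      ext z
      simp
    rw [this, dimH_union]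
    exact max_lt ((hA f (mem_insert _ _)).dimH_zeros_lt hV (h0 f (mem_insert _ _)))
      (ih (fun g hg => hA g (mem_insert_of_mem _ hg)) fun g hg => h0 g (mem_insert_of_mem _ hg))

end Affine

section Stable

open Filter Topology

variable {E G : Type*} [NormedAddCommGroup E] [NormedSpace ℝ E]
  [NormedAddCommGroup G] [NormedSpace ℝ G]

/-- A function on a product depends on both factors. -/
def IsMixed (f : E × G → ℝ) : Prop :=
  (∃ x x' y, f (x, y) ≠ f (x', y)) ∧ ∃ x y y', f (x, y) ≠ f (x, y')

/-- A set that near a point is one side of a mixed affine hyperplane contains a half-graph. -/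
theorem not_isStable_of_locally_halfSpace {f : E × G → ℝ} (hf : IsAffineFun f)
    (hmix : IsMixed f) {D : Set (E × G)} {p : E × G} (hp : f p = 0)
    (hD : ∀ᶠ w in 𝓝 p, f w ≠ 0 → (w ∈ D ↔ f w < 0)) : ¬ IsStable D := by
  obtain ⟨L, c, h⟩ := hf
  obtain ⟨⟨x, x', y, hx⟩, ⟨z, t, t', ht⟩⟩ := hmix
  have hL1 : L (x - x', 0) ≠ 0 := by
    intro h0
    apply hx
    have : L (x, y) - L (x', y) = 0 := by
      rw [← map_sub]; simpa using h0
    rw [h, h]; linarith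
  have hL2 : L (0, t - t') ≠ 0 := by
    intro h0
    apply ht
    have : L (z, t) - L (z, t') = 0 := by
      rw [← map_sub]; simpa using h0
    rw [h, h]; linarith
  obtain ⟨u, hu⟩ : ∃ u, L (u, 0) = 1 := ⟨(L (x - x', 0))⁻¹ • (x - x'), by
    have : (((L (x - x', 0))⁻¹ • (x - x'), 0) : E × G) = (L (x - x', 0))⁻¹ • (x - x', 0) := by
      ext <;> simp
    rw [this, map_smul, smul_eq_mul, inv_mul_cancel₀ hL1]⟩
  obtain ⟨v, hv⟩ : ∃ v, L (0, v) = 1 := ⟨(L (0, t - t'))⁻¹ • (t - t'), by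
    have : ((0, (L (0, t - t'))⁻¹ • (t - t')) : E × G) = (L (0, t - t'))⁻¹ • (0, t - t') := by
      ext <;> simp
    rw [this, map_smul, smul_eq_mul, inv_mul_cancel₀ hL2]⟩
  have hval : ∀ a b : ℝ, f (p.1 + a • u, p.2 - b • v) = a - b := by
    intro a b
    have e : ((p.1 + a • u, p.2 - b • v) : E × G) = p + a • (u, 0) - b • (0, v) := by
      ext <;> simp
    rw [e, h, map_sub, map_add, map_smul, map_smul, hu, hv]
    rw [h] at hp
    simp only [smul_eq_mul, mul_one]
    linarith
  have hcont : Tendsto (fun q : ℝ × ℝ => ((p.1 + q.1 • u, p.2 - q.2 • v) : E × G))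
      (𝓝 (0, 0)) (𝓝 p) := by
    have : Continuous (fun q : ℝ × ℝ => ((p.1 + q.1 • u, p.2 - q.2 • v) : E × G)) := by fun_prop
    simpa using this.tendsto (0, 0)
  obtain ⟨r, hr, hball⟩ := Metric.eventually_nhds_iff.1 (hcont.eventually hD)
  have key : ∀ a b : ℝ, 1 ≤ a → 1 ≤ b → a ≠ b →
      (((p.1 + (-(r / 2) / a) • u, p.2 - (-(r / 2) / b) • v) : E × G) ∈ D ↔ a < b) := by
    intro a b ha hb hab
    have ha0 : 0 < a := by linarith
    have hb0 : 0 < b := by linarith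
    have hsmall : ∀ a : ℝ, 1 ≤ a → |-(r / 2) / a| < r := fun a ha => by
      rw [abs_div, abs_neg, abs_of_pos (by linarith : 0 < r / 2), abs_of_pos (by linarith : 0 < a)]
      exact (div_le_self (by linarith) ha).trans_lt (by linarith)
    have e : -(r / 2) / a - -(r / 2) / b = (r / 2) * (a - b) / (a * b) := by
      field_simp
      ring
    have hne : f (p.1 + (-(r / 2) / a) • u, p.2 - (-(r / 2) / b) • v) ≠ 0 := by
      rw [hval, e]
      exact div_ne_zero (mul_ne_zero (by linarith) (sub_ne_zero.2 hab)) (by positivity)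
    have hd : dist ((-(r / 2) / a, -(r / 2) / b) : ℝ × ℝ) (0, 0) < r := by
      rw [Prod.dist_eq, max_lt_iff, Real.dist_0_eq_abs, Real.dist_0_eq_abs]
      exact ⟨hsmall a ha, hsmall b hb⟩
    rw [hball hd hne]
    rw [hval, e, div_neg_iff]
    have hab0 : 0 < a * b := by positivity
    constructor
    · rintro (⟨_, h2⟩ | ⟨h1, _⟩)
      · linarith
      · by_contra! hle
        have : 0 ≤ r / 2 * (a - b) := mul_nonneg (by linarith) (by linarith)
        linarith
    · intro hlt
      exact Or.inr ⟨mul_neg_of_pos_of_neg (by linarith) (by linarith), hab0⟩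
  refine not_not.2 ⟨fun i => p.1 + (-(r / 2) / ((i : ℝ) + 1)) • u,
    fun j => p.2 - (-(r / 2) / ((j : ℝ) + 3 / 2)) • v, fun i j => ?_⟩
  have hi : (0 : ℝ) ≤ i := i.cast_nonneg
  have hj : (0 : ℝ) ≤ j := j.cast_nonneg
  rw [key _ _ (by linarith) (by linarith) ?_]
  · constructor
    · intro hlt
      have : (i : ℝ) < (j : ℝ) + 1 := by linarith
      exact Nat.lt_succ_iff.1 (by exact_mod_cast this)
    · intro hle
      have : (i : ℝ) ≤ j := by exact_mod_cast hle
      linarith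
  · intro heq
    have h1 : (2 * i : ℝ) = 2 * j + 1 := by linarith
    have h2 : 2 * i = 2 * j + 1 := by exact_mod_cast h1
    omega

/-- Near a point where only multiples of a single mixed `f ∈ F` vanish, a stable set which is
determined by the signs of the functions in `F` is locally constant off `{f = 0}`. -/
theorem eventually_mem_or_eventually_notMem {F : Set (E × G → ℝ)} (hF : F.Finite)
    (hA : ∀ f ∈ F, IsAffineFun f) {D : Set (E × G)} (hD : IsStable D)
    (hDF : ∀ z w, (∀ f ∈ F, f z < 0 ↔ f w < 0) → z ∈ D → w ∈ D) {p : E × G}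
    (hmix : ∀ f ∈ F, f ≠ 0 → f p = 0 → IsMixed f)
    (hprop : ∀ f ∈ F, ∀ g ∈ F, f ≠ 0 → g ≠ 0 → f p = 0 → g p = 0 → ∃ c : ℝ, c ≠ 0 ∧ g = c • f) :
    (∀ᶠ w in 𝓝 p, (∀ f ∈ F, f ≠ 0 → f w ≠ 0) → w ∈ D) ∨
      ∀ᶠ w in 𝓝 p, (∀ f ∈ F, f ≠ 0 → f w ≠ 0) → w ∉ D := by
  have hW : ∀ᶠ w in 𝓝 p, ∀ g ∈ F, g p ≠ 0 → (g w < 0 ↔ g p < 0) := by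
    refine (eventually_all_finite hF).2 fun g hg => ?_
    rcases lt_trichotomy (g p) 0 with h | h | h
    · filter_upwards [(hA g hg).continuous.continuousAt.eventually_lt_const h] with w hw
      simp [hw, h]
    · exact Eventually.of_forall fun w h' => (h' h).elim
    · filter_upwards [(hA g hg).continuous.continuousAt.eventually_const_lt h] with w hw
      simp [hw.not_gt, h.not_gt]
  obtain ⟨W, hWp, hW⟩ := hW.exists_mem
  by_cases hex : ∃ f ∈ F, f ≠ 0 ∧ f p = 0
  · obtain ⟨f, hf, hf0, hfp⟩ := hex
    have hsame : ∀ w ∈ W, ∀ w' ∈ W, 0 < f w * f w' → w ∈ D → w' ∈ D := by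
      intro w hw w' hw' hpos
      refine hDF w w' fun g hg => ?_
      by_cases hgp : g p = 0
      · by_cases hg0 : g = 0
        · simp [hg0]
        · obtain ⟨c, hc, rfl⟩ := hprop f hf g hg hf0 hg0 hfp hgp
          have hcc : 0 < c * c := mul_self_pos.2 hc
          have : 0 < (c * f w) * (c * f w') := by nlinarith
          simp only [Pi.smul_apply, smul_eq_mul]
          constructor <;> intro h <;> nlinarith
      · rw [hW w hw g hg hgp, hW w' hw' g hg hgp]
    by_cases hneg : ∃ w ∈ W, f w < 0 ∧ w ∈ D <;> by_cases hpos : ∃ w ∈ W, 0 < f w ∧ w ∈ D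
    · left
      obtain ⟨a, ha, ha', haD⟩ := hneg
      obtain ⟨b, hb, hb', hbD⟩ := hpos
      filter_upwards [hWp] with w hw hwF
      rcases lt_or_gt_of_ne (hwF f hf hf0) with h | h
      · exact hsame a ha w hw (mul_pos_of_neg_of_neg ha' h) haD
      · exact hsame b hb w hw (mul_pos hb' h) hbD
    · obtain ⟨a, ha, ha', haD⟩ := hneg
      refine (not_isStable_of_locally_halfSpace (hA f hf) (hmix f hf hf0 hfp) hfp ?_ hD).elim
      filter_upwards [hWp] with w hw hwf
      refine ⟨fun hwD => ?_, fun h => hsame a ha w hw (mul_pos_of_neg_of_neg ha' h) haD⟩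
      exact lt_of_le_of_ne (not_lt.1 fun h => hpos ⟨w, hw, h, hwD⟩) hwf
    · obtain ⟨a, ha, ha', haD⟩ := hpos
      have hmix' : IsMixed ((-1 : ℝ) • f) := by
        obtain ⟨⟨x, x', y, hx⟩, ⟨z, t, t', ht⟩⟩ := hmix f hf hf0 hfp
        exact ⟨⟨x, x', y, by simpa using hx⟩, ⟨z, t, t', by simpa using ht⟩⟩
      refine (not_isStable_of_locally_halfSpace ((hA f hf).smul (-1)) hmix' (p := p)
        (by simp [hfp]) ?_ hD).elim
      filter_upwards [hWp] with w hw hwf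
      simp only [Pi.smul_apply, smul_eq_mul, neg_mul, one_mul, neg_lt_zero, ne_eq,
        neg_eq_zero] at hwf ⊢
      refine ⟨fun hwD => ?_, fun h => hsame a ha w hw (mul_pos ha' h) haD⟩
      exact lt_of_le_of_ne (not_lt.1 fun h => hneg ⟨w, hw, h, hwD⟩) (Ne.symm hwf)
    · right
      filter_upwards [hWp] with w hw hwF hwD
      rcases lt_or_gt_of_ne (hwF f hf hf0) with h | h
      · exact hneg ⟨w, hw, h, hwD⟩
      · exact hpos ⟨w, hw, h, hwD⟩
  · push Not at hex
    have hsame : ∀ w ∈ W, ∀ w' ∈ W, w ∈ D → w' ∈ D := by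
      intro w hw w' hw'
      refine hDF w w' fun g hg => ?_
      by_cases hg0 : g = 0
      · simp [hg0]
      · rw [hW w hw g hg (hex g hg hg0), hW w' hw' g hg (hex g hg hg0)]
    by_cases hp : p ∈ D
    · left
      filter_upwards [hWp] with w hw _
      exact hsame p (mem_of_mem_nhds hWp) w hw hp
    · right
      filter_upwards [hWp] with w hw _ hwD
      exact hp (hsame w hw p (mem_of_mem_nhds hWp) hwD)

/-- On a convex open set where only mixed functions from `F` vanish, a stable set determined by
the signs of the functions in `F` is constant off the zero sets. -/
theorem mem_of_mem_of_convex [FiniteDimensional ℝ E] [FiniteDimensional ℝ G]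
    (hEG : 0 < Module.finrank ℝ (E × G)) {F : Set (E × G → ℝ)} (hF : F.Finite)
    (hA : ∀ f ∈ F, IsAffineFun f) {D : Set (E × G)} (hD : IsStable D)
    (hDF : ∀ z w, (∀ f ∈ F, f z < 0 ↔ f w < 0) → z ∈ D → w ∈ D) {U : Set (E × G)}
    (hUo : IsOpen U) (hUc : Convex ℝ U)
    (hmix : ∀ p ∈ U, ∀ f ∈ F, f ≠ 0 → f p = 0 → IsMixed f) {z z' : E × G}
    (hz : z ∈ U) (hz' : z' ∈ U) (hzF : ∀ f ∈ F, f ≠ 0 → f z ≠ 0)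
    (hzF' : ∀ f ∈ F, f ≠ 0 → f z' ≠ 0) (hzD : z ∈ D) : z' ∈ D := by
  have dense_of : ∀ H : Set (E × G → ℝ), H.Finite → (∀ f ∈ H, IsAffineFun f) →
      Dense {w | ∀ f ∈ H, f ≠ 0 → f w ≠ 0} := by
    intro H hH hHA
    have := dense_compl_of_dimH_lt_finrank (dimH_iUnion_zeros_lt hEG
      (hH.subset (sep_subset H (· ≠ 0))) (fun f hf => hHA f hf.1) fun f hf => hf.2)
    refine Dense.mono (fun w hw => ?_) this
    exact fun f hf hf0 hfw => hw ⟨f, ⟨hf, hf0⟩, hfw⟩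
  have hZ := dense_of F hF hA
  let comb : (E × G → ℝ) × (E × G → ℝ) → E × G → ℝ := fun q => q.1 z • q.2 + (-q.2 z) • q.1
  have hH := dense_of (comb '' F ×ˢ F) ((hF.prod hF).image comb) (by
    rintro _ ⟨⟨f, g⟩, ⟨hf, hg⟩, rfl⟩
    exact ((hA g hg).smul _).add ((hA f hf).smul _))
  have hW : ∀ᶠ w in 𝓝 z', w ∈ U ∧ ∀ g ∈ F, g ≠ 0 → (g w < 0 ↔ g z' < 0) ∧ g w ≠ 0 := by
    refine (hUo.eventually_mem hz').and ((eventually_all_finite hF).2 fun g hg => ?_)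
    by_cases hg0 : g = 0
    · exact Eventually.of_forall fun w h' => (h' hg0).elim
    rcases lt_or_gt_of_ne (hzF' g hg hg0) with h | h
    · filter_upwards [(hA g hg).continuous.continuousAt.eventually_lt_const h] with w hw _
      simp [hw, h, hw.ne]
    · filter_upwards [(hA g hg).continuous.continuousAt.eventually_const_lt h] with w hw _
      simp [hw.not_gt, h.not_gt, hw.ne']
  obtain ⟨y, hyH, hyU, hy⟩ := hH.inter_nhds_nonempty hW
  suffices hyD : y ∈ D by
    refine hDF y z' (fun g hg => ?_) hyD
    by_cases hg0 : g = 0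
    · simp [hg0]
    · exact (hy g hg hg0).1
  let A : Set (E × G) := {p | ∀ᶠ w in 𝓝 p, (∀ f ∈ F, f ≠ 0 → f w ≠ 0) → w ∈ D}
  let B : Set (E × G) := {p | ∀ᶠ w in 𝓝 p, (∀ f ∈ F, f ≠ 0 → f w ≠ 0) → w ∉ D}
  have hAB : Disjoint A B := by
    rw [Set.disjoint_left]
    intro p hpA hpB
    obtain ⟨w, hw, hwA, hwB⟩ := hZ.inter_nhds_nonempty (inter_mem hpA hpB)
    exact hwB hw (hwA hw)
  have hseg : segment ℝ z y ⊆ A ∪ B := by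
    intro p hp
    have hpU : p ∈ U := hUc.segment_subset hz hyU hp
    obtain ⟨a, b, -, -, hab, rfl⟩ := hp
    refine eventually_mem_or_eventually_notMem hF hA hD hDF (hmix _ hpU) ?_
    intro f hf g hg hf0 hg0 hfp hgp
    have hfz := hzF f hf hf0
    have hgz := hzF g hg hg0
    rw [(hA f hf).apply_lineMap _ _ _ _ hab] at hfp
    rw [(hA g hg).apply_lineMap _ _ _ _ hab] at hgp
    have hb : b ≠ 0 := by
      rintro rfl
      apply hfz
      have : a = 1 := by linarith
      simpa [this] using hfp
    have hcomb : comb (f, g) y = 0 := by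
      have : b * comb (f, g) y = 0 := by
        simp only [comb, Pi.add_apply, Pi.smul_apply, smul_eq_mul]
        linear_combination f z * hgp - g z * hfp
      exact (mul_eq_zero.1 this).resolve_left hb
    have hzero : comb (f, g) = 0 := by
      by_contra hne
      exact hyH _ ⟨(f, g), ⟨hf, hg⟩, rfl⟩ hne hcomb
    refine ⟨g z / f z, div_ne_zero hgz hfz, funext fun w => ?_⟩
    have := congrFun hzero w
    simp only [comb, Pi.add_apply, Pi.smul_apply, smul_eq_mul, Pi.zero_apply] at this ⊢
    field_simp
    linarith
  have hzA : z ∈ A := by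
    refine (hseg (left_mem_segment ℝ z y)).resolve_right fun hzB => ?_
    exact hzB.self_of_nhds hzF hzD
  have hsub := (convex_segment z y).isPreconnected.subset_left_of_subset_union
    (isOpen_iff_mem_nhds.2 fun p hp => hp.eventually_nhds)
    (isOpen_iff_mem_nhds.2 fun p hp => hp.eventually_nhds) hAB hseg
    ⟨z, left_mem_segment ℝ z y, hzA⟩
  have hyA : y ∈ A := hsub (right_mem_segment ℝ z y)
  exact hyA.self_of_nhds fun g hg hg0 => (hy g hg hg0).2

end Stable

/-! ### Sign cells -/

section SignCell

/-- The points where the functions in `F` that belong to `P` are negative and the others are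
positive. -/
def signCell {V : Type*} (F P : Set (V → ℝ)) : Set V :=
  {x | ∀ f ∈ F, (f ∈ P → f x < 0) ∧ (f ∉ P → 0 < f x)}

theorem signCell_eq_iInter {V : Type*} (F P : Set (V → ℝ)) [DecidablePred (· ∈ P)] :
    signCell F P = ⋂ f : F, {x | (if (f : V → ℝ) ∈ P then (f : V → ℝ) else -f) x < 0} := by
  ext x
  simp only [signCell, mem_ofPred_eq, mem_iInter, Subtype.forall]
  refine forall₂_congr fun f hf => ?_
  by_cases h : f ∈ P <;> simp [h]

theorem mem_signCell_of_forall_ne {V : Type*} {F : Set (V → ℝ)} {x : V} (hx : ∀ f ∈ F, f x ≠ 0) :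
    x ∈ signCell F {f | f ∈ F ∧ f x < 0} :=
  fun f hf => ⟨fun h => h.2, fun h => lt_of_le_of_ne (not_lt.1 fun h' => h ⟨hf, h'⟩) (hx f hf).symm⟩

theorem ne_zero_of_mem_signCell {V : Type*} {F P : Set (V → ℝ)} {x : V} (hx : x ∈ signCell F P)
    {f : V → ℝ} (hf : f ∈ F) : f x ≠ 0 := by
  by_cases h : f ∈ P
  · exact ((hx f hf).1 h).ne
  · exact ((hx f hf).2 h).ne'

theorem lt_zero_iff_of_mem_signCell {V : Type*} {F P : Set (V → ℝ)} {x : V}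
    (hx : x ∈ signCell F P) {f : V → ℝ} (hf : f ∈ F) : f x < 0 ↔ f ∈ P :=
  ⟨fun h => by_contra fun h' => ((hx f hf).2 h').not_gt h, (hx f hf).1⟩

variable {V : Type*} [NormedAddCommGroup V] [NormedSpace ℝ V]

open Classical in
theorem isOpen_signCell {F : Set (V → ℝ)} (hF : F.Finite) (hA : ∀ f ∈ F, IsAffineFun f)
    (P : Set (V → ℝ)) : IsOpen (signCell F P) := by
  have : Finite F := hF
  rw [signCell_eq_iInter]
  refine isOpen_iInter_of_finite fun f => isOpen_lt ?_ continuous_const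
  split_ifs
  exacts [(hA f f.2).continuous, (hA f f.2).continuous.neg]

open Classical in
theorem convex_signCell {F : Set (V → ℝ)} (hA : ∀ f ∈ F, IsAffineFun f) (P : Set (V → ℝ)) :
    Convex ℝ (signCell F P) := by
  rw [signCell_eq_iInter]
  refine convex_iInter fun f => convex_lt_zero ?_
  split_ifs
  · exact hA f f.2
  · simpa using (hA f f.2).smul (-1)

open Classical in
theorem definable_signCell {ι : Type*} {F : Set ((ι → ℝ) → ℝ)} (hF : F.Finite)
    (hF' : F ⊆ linFun ι) (P : Set ((ι → ℝ) → ℝ)) :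
    (univ : Set ℝ).Definable OAGLang (signCell F P) := by
  have : Finite F := hF
  rw [signCell_eq_iInter]
  refine definable_iInter_of_finite fun f => definable_lt_zero ?_
  split_ifs
  exacts [hF' f.2, neg_mem (hF' f.2)]

theorem isAffineFun_coord {ι : Type*} [Fintype ι] (i : ι) : IsAffineFun (fun v : ι → ℝ => v i) :=
  ⟨ContinuousLinearMap.proj i, 0, fun z => by simp⟩

theorem isAffineFun_const (c : ℝ) : IsAffineFun (fun _ : V => c) :=
  ⟨0, c, fun z => by simp⟩

theorem IsAffineFun.of_mem_linFun {ι : Type*} [Fintype ι] {f : (ι → ℝ) → ℝ}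
    (hf : f ∈ linFun ι) : IsAffineFun f :=
  linFun_induction isAffineFun_coord isAffineFun_const (fun _ _ hf hg => hf.add hg)
    (fun q f hf => by simpa [Rat.cast_smul_eq_qsmul] using hf.smul (q : ℝ)) hf

end SignCell

section Append

variable {m n : ℕ}

/-- The continuous linear identification of `ℝ^m × ℝ^n` with `ℝ^(m+n)`. -/
noncomputable def appendL (m n : ℕ) :
    ((Fin m → ℝ) × (Fin n → ℝ)) →L[ℝ] (Fin (m + n) → ℝ) :=
  ContinuousLinearMap.pi (Fin.addCases
    (fun i => (ContinuousLinearMap.proj i).comp (ContinuousLinearMap.fst ℝ _ _))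
    (fun j => (ContinuousLinearMap.proj j).comp (ContinuousLinearMap.snd ℝ _ _)))

@[simp]
theorem appendL_castAdd (z : (Fin m → ℝ) × (Fin n → ℝ)) (i : Fin m) :
    appendL m n z (Fin.castAdd n i) = z.1 i := by
  simp [appendL]

@[simp]
theorem appendL_natAdd (z : (Fin m → ℝ) × (Fin n → ℝ)) (j : Fin n) :
    appendL m n z (Fin.natAdd m j) = z.2 j := by
  simp [appendL]

theorem joinR_appendL (z : (Fin m → ℝ) × (Fin n → ℝ)) : joinR m n (appendL m n z) = z := by
  ext <;> simp [joinR]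

theorem linFun_append_left {f : (Fin (m + n) → ℝ) → ℝ} (hf : f ∈ linFun (Fin (m + n))) :
    (fun x => f (appendL m n (x, 0))) ∈ linFun (Fin m) := by
  refine linFun_comp (fun i => ?_) hf
  refine Fin.addCases (fun i => ?_) (fun j => ?_) i
  · simpa using coord_mem_linFun i
  · simpa using const_mem_linFun 0

theorem linFun_append_right {f : (Fin (m + n) → ℝ) → ℝ} (hf : f ∈ linFun (Fin (m + n))) :
    (fun y => f (appendL m n (0, y))) ∈ linFun (Fin n) := by
  refine linFun_comp (fun i => ?_) hf
  refine Fin.addCases (fun i => ?_) (fun j => ?_) i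
  · simpa using const_mem_linFun 0
  · simpa using coord_mem_linFun j

end Append

/-- An affine function on a product that vanishes at a point, but whose restrictions to the two
axes do not vanish at the projections of that point unless they are zero, is mixed. -/
theorem isMixed_of_apply_eq_zero {E G : Type*} [NormedAddCommGroup E] [NormedSpace ℝ E]
    [NormedAddCommGroup G] [NormedSpace ℝ G] {f : E × G → ℝ} (hf : IsAffineFun f) (h0 : f ≠ 0)
    {p : E × G} (hp : f p = 0) (hl : (fun x => f (x, 0)) ≠ 0 → f (p.1, 0) ≠ 0)
    (hr : (fun y => f (0, y)) ≠ 0 → f (0, p.2) ≠ 0) : IsMixed f := by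
  obtain ⟨L, c, h⟩ := hf
  have hsplit : ∀ x y, f (x, y) + f (0, 0) = f (x, 0) + f (0, y) := fun x y => by
    have : ((x, y) : E × G) = (x, 0) + (0, y) := by simp
    rw [h, h, h, h, this, map_add, show ((0, 0) : E × G) = 0 from rfl, map_zero]
    ring
  constructor
  · by_contra! hcon
    refine hr (fun hz => h0 ?_) (by rw [hcon 0 p.1 p.2]; exact hp)
    funext z
    exact (hcon z.1 0 z.2).trans (congrFun hz z.2)
  · by_contra! hcon
    refine hl (fun hz => h0 ?_) (by rw [hcon p.1 0 p.2]; exact hp)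
    funext z
    exact (hcon z.1 z.2 0).trans (congrFun hz z.1)

theorem stmt4 (m n : ℕ) (hm : 1 ≤ m) (hn : 1 ≤ n)
    (X : Set (Fin m → ℝ)) (Y : Set (Fin n → ℝ)) (D : Set ((Fin m → ℝ) × (Fin n → ℝ)))
    (hX : Set.Definable (Set.univ : Set ℝ) OAGLang X)
    (hY : Set.Definable (Set.univ : Set ℝ) OAGLang Y)
    (hDsub : D ⊆ X ×ˢ Y)
    (hD : Set.Definable (Set.univ : Set ℝ) OAGLang (joinR m n ⁻¹' D))
    (hstable : IsStable D)
    (hdX : dimH X = (m : ℝ≥0∞)) (hdY : dimH Y = (n : ℝ≥0∞))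
    (hdD : dimH D = ((m + n : ℕ) : ℝ≥0∞)) :
    ∃ (k : ℕ) (Xs : Fin k → Set (Fin m → ℝ)) (Ys : Fin k → Set (Fin n → ℝ)),
      (∀ i, Set.Definable (Set.univ : Set ℝ) OAGLang (Xs i)) ∧
      (∀ i, Set.Definable (Set.univ : Set ℝ) OAGLang (Ys i)) ∧
      (∀ i, Xs i ⊆ X) ∧ (∀ i, Ys i ⊆ Y) ∧
      (∀ i, dimH (Xs i) = (m : ℝ≥0∞)) ∧ (∀ i, dimH (Ys i) = (n : ℝ≥0∞)) ∧
      dimH (symmDiff D (⋃ i, (Xs i) ×ˢ (Ys i))) < ((m + n : ℕ) : ℝ≥0∞) := by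
  have hfin : Module.finrank ℝ ((Fin m → ℝ) × (Fin n → ℝ)) = m + n := by simp
  have hpos : 0 < Module.finrank ℝ ((Fin m → ℝ) × (Fin n → ℝ)) := by omega
  obtain ⟨F, hF, hFlin, hFD⟩ := hD.isSemilinear
  obtain ⟨FX₀, hFX₀, hFX₀lin, hFX₀X⟩ := hX.isSemilinear
  obtain ⟨FY₀, hFY₀, hFY₀lin, hFY₀Y⟩ := hY.isSemilinear
  let FD : Set ((Fin m → ℝ) × (Fin n → ℝ) → ℝ) := (fun f => f ∘ appendL m n) '' F
  let FX : Set ((Fin m → ℝ) → ℝ) := (FX₀ ∪ (fun f x => f (appendL m n (x, 0))) '' F) \ {0}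
  let FY : Set ((Fin n → ℝ) → ℝ) := (FY₀ ∪ (fun f y => f (appendL m n (0, y))) '' F) \ {0}
  have hFDfin : FD.Finite := hF.image _
  have hFXfin : FX.Finite := (hFX₀.union (hF.image _)).sdiff
  have hFYfin : FY.Finite := (hFY₀.union (hF.image _)).sdiff
  have hFXlin : FX ⊆ linFun (Fin m) := by
    rintro _ ⟨hf | ⟨f, hf, rfl⟩, -⟩
    exacts [hFX₀lin hf, linFun_append_left (hFlin hf)]
  have hFYlin : FY ⊆ linFun (Fin n) := by
    rintro _ ⟨hf | ⟨f, hf, rfl⟩, -⟩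
    exacts [hFY₀lin hf, linFun_append_right (hFlin hf)]
  have hFDA : ∀ f ∈ FD, IsAffineFun f := by
    rintro _ ⟨f, hf, rfl⟩
    exact (IsAffineFun.of_mem_linFun (hFlin hf)).comp _
  have hFXA : ∀ f ∈ FX, IsAffineFun f := fun f hf => .of_mem_linFun (hFXlin hf)
  have hFYA : ∀ f ∈ FY, IsAffineFun f := fun f hf => .of_mem_linFun (hFYlin hf)
  have hFDD : ∀ z w, (∀ f ∈ FD, f z < 0 ↔ f w < 0) → z ∈ D → w ∈ D := by
    intro z w hzw hz
    have := hFD (appendL m n z) (appendL m n w) (fun f hf => hzw _ ⟨f, hf, rfl⟩)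
      (by simpa [joinR_appendL] using hz)
    simpa [joinR_appendL] using this
  have hXcell : ∀ P, ∀ x ∈ signCell FX P, ∀ x' ∈ signCell FX P, x ∈ X → x' ∈ X := by
    intro P x hx x' hx'
    refine hFX₀X x x' fun f hf => ?_
    by_cases h0 : f = 0
    · simp [h0]
    · have hfX : f ∈ FX := ⟨Or.inl hf, h0⟩
      rw [lt_zero_iff_of_mem_signCell hx hfX, lt_zero_iff_of_mem_signCell hx' hfX]
  have hYcell : ∀ P, ∀ y ∈ signCell FY P, ∀ y' ∈ signCell FY P, y ∈ Y → y' ∈ Y := by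
    intro P y hy y' hy'
    refine hFY₀Y y y' fun f hf => ?_
    by_cases h0 : f = 0
    · simp [h0]
    · have hfY : f ∈ FY := ⟨Or.inl hf, h0⟩
      rw [lt_zero_iff_of_mem_signCell hy hfY, lt_zero_iff_of_mem_signCell hy' hfY]
  have hmix : ∀ P Q, ∀ p ∈ signCell FX P ×ˢ signCell FY Q, ∀ f ∈ FD, f ≠ 0 → f p = 0 →
      IsMixed f := by
    rintro P Q p ⟨hpX, hpY⟩ f hf h0 hfp
    obtain ⟨g, hg, rfl⟩ := id hf
    refine isMixed_of_apply_eq_zero (hFDA _ hf) h0 hfp (fun h => ?_) (fun h => ?_)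
    · exact ne_zero_of_mem_signCell hpX (f := fun x => g (appendL m n (x, 0)))
        ⟨Or.inr ⟨g, hg, rfl⟩, h⟩
    · exact ne_zero_of_mem_signCell hpY (f := fun y => g (appendL m n (0, y)))
        ⟨Or.inr ⟨g, hg, rfl⟩, h⟩
  let FZ : Set ((Fin m → ℝ) × (Fin n → ℝ) → ℝ) :=
    FD \ {0} ∪ ((fun f => f ∘ Prod.fst) '' FX ∪ (fun f => f ∘ Prod.snd) '' FY)
  let Z : Set ((Fin m → ℝ) × (Fin n → ℝ)) := {z | ∃ f ∈ FZ, f z = 0}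
  have hZ : dimH Z < ((m + n : ℕ) : ℝ≥0∞) := by
    rw [← hfin]
    refine dimH_iUnion_zeros_lt hpos (hFDfin.sdiff.union ((hFXfin.image _).union
      (hFYfin.image _))) ?_ ?_
    · rintro _ (hf | ⟨f, hf, rfl⟩ | ⟨f, hf, rfl⟩)
      · exact hFDA _ hf.1
      · exact (hFXA f hf).comp (ContinuousLinearMap.fst ℝ (Fin m → ℝ) (Fin n → ℝ))
      · exact (hFYA f hf).comp (ContinuousLinearMap.snd ℝ (Fin m → ℝ) (Fin n → ℝ))
    · rintro _ (hf | ⟨f, hf, rfl⟩ | ⟨f, hf, rfl⟩) h0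
      · exact hf.2 h0
      · exact hf.2 (funext fun x => congrFun h0 (x, 0))
      · exact hf.2 (funext fun y => congrFun h0 (0, y))
  let J := {q : 𝒫 FX × 𝒫 FY // ∃ z ∈ signCell FX q.1 ×ˢ signCell FY q.2, z ∉ Z ∧ z ∈ D}
  have : Finite (𝒫 FX) := hFXfin.finite_subsets
  have : Finite (𝒫 FY) := hFYfin.finite_subsets
  obtain ⟨k, ⟨e⟩⟩ := Finite.exists_equiv_fin J
  refine ⟨k, fun i => signCell FX (e.symm i).1.1, fun i => signCell FY (e.symm i).1.2,
    fun i => definable_signCell hFXfin hFXlin _, fun i => definable_signCell hFYfin hFYlin _,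
    fun i x hx => ?_, fun i y hy => ?_, fun i => ?_, fun i => ?_, (dimH_mono ?_).trans_lt hZ⟩
  · obtain ⟨z, hz, -, hzD⟩ := (e.symm i).2
    exact hXcell _ z.1 hz.1 x hx (hDsub hzD).1
  · obtain ⟨z, hz, -, hzD⟩ := (e.symm i).2
    exact hYcell _ z.2 hz.2 y hy (hDsub hzD).2
  · obtain ⟨z, hz, -⟩ := (e.symm i).2
    simpa using Real.dimH_of_mem_nhds ((isOpen_signCell hFXfin hFXA _).mem_nhds hz.1)
  · obtain ⟨z, hz, -⟩ := (e.symm i).2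
    simpa using Real.dimH_of_mem_nhds ((isOpen_signCell hFYfin hFYA _).mem_nhds hz.2)
  · rintro z (⟨hzD, hzU⟩ | ⟨hzU, hzD⟩)
    · by_contra hzZ
      refine hzU (mem_iUnion.2 ?_)
      have hzX := mem_signCell_of_forall_ne (F := FX) (x := z.1)
        fun f hf h => hzZ ⟨_, Or.inr (Or.inl ⟨f, hf, rfl⟩), h⟩
      have hzY := mem_signCell_of_forall_ne (F := FY) (x := z.2)
        fun f hf h => hzZ ⟨_, Or.inr (Or.inr ⟨f, hf, rfl⟩), h⟩
      let j : J := ⟨(⟨_, fun f (hf : f ∈ FX ∧ f z.1 < 0) => hf.1⟩,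
        ⟨_, fun f (hf : f ∈ FY ∧ f z.2 < 0) => hf.1⟩), z, ⟨hzX, hzY⟩, hzZ, hzD⟩
      exact ⟨e j, by simp only [e.symm_apply_apply]; exact ⟨hzX, hzY⟩⟩
    · by_contra hzZ
      obtain ⟨i, hi⟩ := mem_iUnion.1 hzU
      obtain ⟨w, hw, hwZ, hwD⟩ := (e.symm i).2
      refine hzD (mem_of_mem_of_convex hpos hFDfin hFDA hstable hFDD
        ((isOpen_signCell hFXfin hFXA _).prod (isOpen_signCell hFYfin hFYA _))
        ((convex_signCell hFXA _).prod (convex_signCell hFYA _)) (hmix _ _) hw hi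
        (fun f hf h0 h => hwZ ⟨f, Or.inl ⟨hf, h0⟩, h⟩)
        (fun f hf h0 h => hzZ ⟨f, Or.inl ⟨hf, h0⟩, h⟩) hwD)
end
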